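/- arXiv:0708.2636 — 6 statements merged into one kernel-verified Lean document; each statement's English description precedes it below -/
import Mathlib

section
/- Let β be a skew F-endomorphism of V. Then there exists a totally isotropic flag {0} ⊂ V₁ ⊂ V₂ ⊂ V₃ ⊂ V with βV₁ ⊆ V₂ and βV₂ ⊆ V₃ if and only if the quadratic form v ↦ h(v, βv) on V has a nontrivial isotropic vector, i.e. there exists v ∈ V with v ≠ 0 and h(v, βv) = 0. (Proposition 4.1, equivalence (iii)⇔(iv).) -/
/-- Encoding of a nonarchimedean local field via a (normalized, surjective)
additive valuation `ν : K → ℤ` with junk value at `0`:  `ν` is additive on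
products and ultrametric on nonzero elements, `ν(K^×) = ℤ`, the field is
complete (every `ν`-Cauchy sequence converges), and the residue field is
finite (finitely many residue classes of integers). -/
structure IsNALocalField {K : Type*} [Field K] (ν : K → ℤ) : Prop where
  map_mul : ∀ x y : K, x ≠ 0 → y ≠ 0 → ν (x * y) = ν x + ν y
  ultrametric : ∀ x y : K, x ≠ 0 → y ≠ 0 → x + y ≠ 0 → min (ν x) (ν y) ≤ ν (x + y)
  surj : ∀ n : ℤ, ∃ x : K, x ≠ 0 ∧ ν x = n
  complete : ∀ a : ℕ → K,
    (∀ N : ℤ, ∃ M : ℕ, ∀ m ≥ M, ∀ n ≥ M, a m = a n ∨ N ≤ ν (a m - a n)) →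
    ∃ L : K, ∀ N : ℤ, ∃ M : ℕ, ∀ m ≥ M, a m = L ∨ N ≤ ν (a m - L)
  finiteResidue : ∃ S : Finset K, ∀ x : K, (x = 0 ∨ 0 ≤ ν x) →
    ∃ y ∈ S, x = y ∨ 0 < ν (x - y)

/-- Odd residual characteristic: `2` is a unit of the valuation ring
(equivalently, the characteristic of the residue field is odd). -/
def OddResidualChar {K : Type*} [Field K] (ν : K → ℤ) : Prop :=
  (2 : K) ≠ 0 ∧ ν (2 : K) = 0

/-- A line and a plane containing it, in a space with an alternating form, extend by the
orthogonal complement of the line to a flag; the flag is adapted to `β` under the evident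
conditions on the spanning vectors. -/
theorem exists_flag_of_span_pair
    {F V : Type*} [Field F] [AddCommGroup V] [Module F V] [FiniteDimensional F V]
    (hdim : Module.finrank F V = 4) (h : V →ₗ[F] V →ₗ[F] F) (halt : h.IsAlt)
    (β : V →ₗ[F] V) {v w : V} (hv : h v ≠ 0) (hvw : LinearIndependent F ![v, w])
    (hw : h v w = 0) (hβv : h v (β v) = 0) (hβw : h v (β w) = 0)
    (hmem : β v ∈ Submodule.span F {v, w}) :
    ∃ V₁ V₂ V₃ : Submodule F V,
        Module.finrank F V₁ = 1 ∧ Module.finrank F V₂ = 2 ∧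
        Module.finrank F V₃ = 3 ∧
        V₁ ≤ V₂ ∧ V₂ ≤ V₃ ∧
        (∀ v ∈ V₂, ∀ w ∈ V₂, h v w = 0) ∧
        (∀ w : V, w ∈ V₃ ↔ ∀ v ∈ V₁, h v w = 0) ∧
        Submodule.map β V₁ ≤ V₂ ∧ Submodule.map β V₂ ≤ V₃ := by
  have hv0 : v ≠ 0 := by
    rintro rfl
    exact hv (map_zero h)
  have hwv : h w v = 0 := by rw [← halt.neg, hw, neg_zero]
  refine ⟨Submodule.span F {v}, Submodule.span F {v, w}, LinearMap.ker (h v),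
    finrank_span_singleton hv0, ?_, ?_, Submodule.span_mono (by simp), ?_, ?_, ?_, ?_, ?_⟩
  · rw [← Matrix.range_cons_cons_empty v w ![], finrank_span_eq_card hvw, Fintype.card_fin]
  · have := Module.Dual.finrank_ker_add_one_of_ne_zero hv
    omega
  · rw [Submodule.span_le, Set.pair_subset_iff]
    exact ⟨halt v, hw⟩
  · intro x hx y hy
    obtain ⟨a, b, rfl⟩ := Submodule.mem_span_pair.1 hx
    obtain ⟨c, d, rfl⟩ := Submodule.mem_span_pair.1 hy
    simp [hw, hwv, halt.self_eq_zero]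
  · intro y
    rw [LinearMap.mem_ker]
    refine ⟨fun hy x hx => ?_, fun hy => hy v (Submodule.mem_span_singleton_self v)⟩
    obtain ⟨a, rfl⟩ := Submodule.mem_span_singleton.1 hx
    simp [hy]
  · rw [Submodule.map_span, Set.image_singleton, Submodule.span_le, Set.singleton_subset_iff]
    exact hmem
  · rw [Submodule.map_span, Set.image_pair, Submodule.span_le, Set.pair_subset_iff]
    exact ⟨hβv, hβw⟩

/-- Proposition 4.1, (iii)⇔(iv).
For a skew endomorphism `β` of a 4-dimensional symplectic space `(V, h)` over a
nonarchimedean local field `F` of odd residual characteristic, there is a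
totally isotropic flag `0 ⊂ V₁ ⊂ V₂ ⊂ V₃ ⊂ V` with `βV₁ ⊆ V₂` and `βV₂ ⊆ V₃`
iff the quadratic form `v ↦ h(v, βv)` has a nontrivial isotropic vector. -/
theorem flag_iff_isotropic
    {F V : Type*} [Field F] [AddCommGroup V] [Module F V] [FiniteDimensional F V]
    (ν : F → ℤ) (hF : IsNALocalField ν) (hodd : OddResidualChar ν)
    (hdim : Module.finrank F V = 4)
    (h : V →ₗ[F] V →ₗ[F] F)
    (halt : ∀ v : V, h v v = 0)
    (hnd : ∀ v : V, (∀ w : V, h v w = 0) → v = 0)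
    (β : V →ₗ[F] V)
    (hskew : ∀ v w : V, h (β v) w = - h v (β w)) :
    (∃ V₁ V₂ V₃ : Submodule F V,
        Module.finrank F V₁ = 1 ∧ Module.finrank F V₂ = 2 ∧
        Module.finrank F V₃ = 3 ∧
        V₁ ≤ V₂ ∧ V₂ ≤ V₃ ∧
        (∀ v ∈ V₂, ∀ w ∈ V₂, h v w = 0) ∧
        (∀ w : V, w ∈ V₃ ↔ ∀ v ∈ V₁, h v w = 0) ∧
        Submodule.map β V₁ ≤ V₂ ∧ Submodule.map β V₂ ≤ V₃) ↔
      ∃ v : V, v ≠ 0 ∧ h v (β v) = 0 := by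
  constructor
  · rintro ⟨V₁, V₂, V₃, h₁, -, -, h₁₂, -, hiso, -, hβ, -⟩
    have : Nontrivial V₁ := Module.nontrivial_of_finrank_pos (R := F) (by omega)
    obtain ⟨v, hv, hv0⟩ := V₁.ne_bot_iff.1 ((Submodule.nontrivial_iff_ne_bot).1 this)
    exact ⟨v, hv0, hiso v (h₁₂ hv) (β v) (hβ (Submodule.mem_map_of_mem hv))⟩
  · rintro ⟨v, hv0, hβv⟩
    have hv : h v ≠ 0 := fun hz => hv0 (hnd v fun w => by rw [hz, LinearMap.zero_apply])
    have hsq (w : V) : h v (β w) = - h (β v) w := by rw [hskew, neg_neg]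
    by_cases hli : LinearIndependent F ![v, β v]
    · exact exists_flag_of_span_pair hdim h halt β hv hli hβv hβv
        (by rw [hsq, halt, neg_zero]) (Submodule.subset_span (by simp))
    · obtain ⟨c, hc⟩ : ∃ c : F, c • v = β v := by
        simpa [LinearIndependent.pair_iff' hv0] using hli
      obtain ⟨w, hw, hwv⟩ : ∃ w ∈ LinearMap.ker (h v), w ∉ Submodule.span F {v} := by
        refine SetLike.not_le_iff_exists.1 fun hle => ?_
        have h₁ := Submodule.finrank_mono hle
        have h₂ := Module.Dual.finrank_ker_add_one_of_ne_zero hv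
        rw [finrank_span_singleton hv0] at h₁
        omega
      rw [LinearMap.mem_ker] at hw
      refine exists_flag_of_span_pair hdim h halt β hv
        ((LinearIndependent.pair_iff' hv0).2 fun a ha => hwv ?_) hw hβv ?_ ?_
      · exact Submodule.mem_span_singleton.2 ⟨a, ha⟩
      · rw [hsq, ← hc, map_smul, LinearMap.smul_apply, hw, smul_zero, neg_zero]
      · exact hc ▸ Submodule.smul_mem _ c (Submodule.subset_span (by simp))
end

section
/- Let β be a skew F-endomorphism of V. There exists a totally isotropic flag {0} ⊂ V₁ ⊂ V₂ ⊂ V₃ ⊂ V such that the restriction of ψ_β to the associated unipotent subgroup U = {g ∈ Sp(V,h) : (g−1)V_i ⊆ V_{i−1} for i = 1,…,4} (where V₀ = 0 and V₄ = V) is a group homomorphism from U to ℂ^×, if and only if there exists v ∈ V with v ≠ 0 and h(v, βv) = 0. (Proposition 4.1, equivalence (i)⇔(iv).) -/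
/-- `g` lies in the maximal unipotent subgroup of `Sp(V,h)` attached to the
flag `0 ⊂ V₁ ⊂ V₂ ⊂ V₃ ⊂ V`: it preserves `h` and satisfies
`(g − 1)Vᵢ ⊆ V_{i−1}` for `i = 1, …, 4` (with `V₀ = 0`, `V₄ = V`). -/
def InFlagUnipotent {F V : Type*} [Field F] [AddCommGroup V] [Module F V]
    (h : V →ₗ[F] V →ₗ[F] F) (V₁ V₂ V₃ : Submodule F V) (g : V →ₗ[F] V) : Prop :=
  (∀ v w : V, h (g v) (g w) = h v w) ∧
  (∀ v ∈ V₁, g v = v) ∧ (∀ v ∈ V₂, g v - v ∈ V₁) ∧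
  (∀ v ∈ V₃, g v - v ∈ V₂) ∧ (∀ v : V, g v - v ∈ V₃)

/-- The square-zero map `w ↦ h(f,w)e + h(e,w)f`, skew for `h` when `h` is alternating. -/
def symmetricTransvection {F V : Type*} [Field F] [AddCommGroup V] [Module F V]
    (h : V →ₗ[F] V →ₗ[F] F) (e f : V) : V →ₗ[F] V :=
  (h f).smulRight e + (h e).smulRight f

section

variable {F V : Type*} [Field F] [AddCommGroup V] [Module F V]

theorem symmetricTransvection_apply (h : V →ₗ[F] V →ₗ[F] F) (e f w : V) :
    symmetricTransvection h e f w = h f w • e + h e w • f := by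
  simp [symmetricTransvection]

theorem inFlagUnipotent_id_add_symmetricTransvection {h : V →ₗ[F] V →ₗ[F] F}
    (halt : ∀ v : V, h v v = 0) {V₁ V₂ V₃ : Submodule F V} (h₁₂ : V₁ ≤ V₂) (h₂₃ : V₂ ≤ V₃)
    (hV₃ : ∀ w : V, w ∈ V₃ ↔ ∀ v ∈ V₁, h v w = 0) {e f : V} (he : e ∈ V₁) (hf : f ∈ V₃)
    (hV₁ : ∀ v ∈ V₁, ∃ c : F, c • e = v) :
    InFlagUnipotent h V₁ V₂ V₃ (LinearMap.id + symmetricTransvection h e f) := by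
  have hneg : ∀ a b : V, h a b = - h b a := fun a b => by
    have := halt (a + b)
    simp only [map_add, LinearMap.add_apply, halt] at this
    linear_combination this
  have hef : h e f = 0 := (hV₃ f).1 hf e he
  have hfe : h f e = 0 := by rw [hneg, hef, neg_zero]
  have key : ∀ w ∈ V₃, h f w • e + h e w • f ∈ V₁ := fun w hw => by
    rw [(hV₃ w).1 hw e he, zero_smul, add_zero]
    exact V₁.smul_mem _ he
  refine ⟨fun v w => ?_, fun v hv => ?_, fun v hv => ?_, fun v hv => ?_, fun v => ?_⟩
  · simp only [LinearMap.add_apply, LinearMap.id_apply, symmetricTransvection_apply, map_add,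
      map_smul, LinearMap.smul_apply, smul_eq_mul, halt, hef, hfe]
    rw [hneg v e, hneg v f]
    ring
  · obtain ⟨c, rfl⟩ := hV₁ v hv
    simp [symmetricTransvection_apply, halt, hfe]
  · simpa [symmetricTransvection_apply] using key v (h₂₃ hv)
  · simpa [symmetricTransvection_apply] using h₁₂ (key v hv)
  · simpa [symmetricTransvection_apply] using
      V₃.add_mem (V₃.smul_mem (h f v) (h₂₃ (h₁₂ he))) (V₃.smul_mem (h e v) hf)

theorem comp_sub_id_eq (β g g' : V →ₗ[F] V) :
    β ∘ₗ (g ∘ₗ g' - LinearMap.id) = β ∘ₗ (g - LinearMap.id) + β ∘ₗ (g' - LinearMap.id) +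
      β ∘ₗ ((g - LinearMap.id) ∘ₗ (g' - LinearMap.id)) := by
  ext v
  simp only [LinearMap.comp_apply, LinearMap.sub_apply, LinearMap.add_apply, LinearMap.id_apply,
    map_sub]
  abel

/-- A vector outside the line spanned by `e` pairs nontrivially with some vector orthogonal to `e`. -/
theorem exists_orthogonal_pairing_ne_zero {h : V →ₗ[F] V →ₗ[F] F}
    (hnd : ∀ v : V, (∀ w : V, h v w = 0) → v = 0) {e u : V}
    (hue : ∀ c : F, c • e ≠ u) (he : e ≠ 0) :
    ∃ w : V, h e w = 0 ∧ h u w ≠ 0 := by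
  by_contra! H
  obtain ⟨w, hw⟩ : ∃ w, h e w ≠ 0 := by
    by_contra! hw
    exact he (hnd e hw)
  refine hue (h u w / h e w) (sub_eq_zero.1 (hnd _ fun x => ?_))
  have := H (x - (h e x / h e w) • w) (by simp [hw])
  simp only [map_sub, map_smul, smul_eq_mul, LinearMap.sub_apply, LinearMap.smul_apply] at this ⊢
  field_simp at this ⊢
  linear_combination -this

theorem trace_comp_eq_zero_of_flag [FiniteDimensional F V] (V₁ V₂ V₃ : Submodule F V)
    {β n n' : V →ₗ[F] V} (hβ₁ : ∀ v ∈ V₁, β v ∈ V₂) (hβ₂ : ∀ v ∈ V₂, β v ∈ V₃)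
    (hn₁ : ∀ v ∈ V₁, n v = 0) (hn₂ : ∀ v ∈ V₂, n v ∈ V₁) (hn₃ : ∀ v ∈ V₃, n v ∈ V₂)
    (hn₂' : ∀ v ∈ V₂, n' v ∈ V₁) (hn₃' : ∀ v ∈ V₃, n' v ∈ V₂) (hn₄' : ∀ v, n' v ∈ V₃) :
    LinearMap.trace F V (β ∘ₗ (n ∘ₗ n')) = 0 := by
  refine (LinearMap.isNilpotent_trace_of_isNilpotent ⟨3, ?_⟩).eq_zero
  ext v
  simp only [pow_succ, pow_zero, one_mul, Module.End.mul_apply, LinearMap.comp_apply,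
    LinearMap.zero_apply]
  rw [hn₁ _ (hn₂' _ (hβ₁ _ (hn₂ _ (hn₃' _ (hβ₂ _ (hn₃ _ (hn₄' v))))))), map_zero]

end

/-- Proposition 4.1, (i)⇔(iv).
There is a totally isotropic flag whose associated maximal unipotent subgroup
`U ⊆ Sp(V,h)` is such that `ψ_β(x) = ψ(tr(β(x−1)))` restricts to a group
homomorphism `U → ℂ^×`, iff the form `v ↦ h(v,βv)` has a nonzero isotropic
vector. -/
theorem psibeta_character_iff_isotropic
    {F V : Type*} [Field F] [AddCommGroup V] [Module F V] [FiniteDimensional F V]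
    (ν : F → ℤ) (hF : IsNALocalField ν) (hodd : OddResidualChar ν)
    (ψ : F → ℂ) (hψadd : ∀ x y : F, ψ (x + y) = ψ x * ψ y) (hψ0 : ψ 0 = 1)
    (hψtriv : ∀ x : F, x ≠ 0 → 0 < ν x → ψ x = 1)
    (hψnt : ∃ x : F, x ≠ 0 ∧ 0 ≤ ν x ∧ ψ x ≠ 1)
    (hdim : Module.finrank F V = 4)
    (h : V →ₗ[F] V →ₗ[F] F)
    (halt : ∀ v : V, h v v = 0)
    (hnd : ∀ v : V, (∀ w : V, h v w = 0) → v = 0)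
    (β : V →ₗ[F] V)
    (hskew : ∀ v w : V, h (β v) w = - h v (β w)) :
    (∃ V₁ V₂ V₃ : Submodule F V,
        Module.finrank F V₁ = 1 ∧ Module.finrank F V₂ = 2 ∧
        Module.finrank F V₃ = 3 ∧
        V₁ ≤ V₂ ∧ V₂ ≤ V₃ ∧
        (∀ v ∈ V₂, ∀ w ∈ V₂, h v w = 0) ∧
        (∀ w : V, w ∈ V₃ ↔ ∀ v ∈ V₁, h v w = 0) ∧
        ∀ g g' : V →ₗ[F] V, InFlagUnipotent h V₁ V₂ V₃ g →
          InFlagUnipotent h V₁ V₂ V₃ g' →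
          ψ (LinearMap.trace F V (β ∘ₗ (g ∘ₗ g' - LinearMap.id))) =
            ψ (LinearMap.trace F V (β ∘ₗ (g - LinearMap.id))) *
              ψ (LinearMap.trace F V (β ∘ₗ (g' - LinearMap.id)))) ↔
      ∃ v : V, v ≠ 0 ∧ h v (β v) = 0 := by
  have hneg : ∀ a b : V, h a b = - h b a := fun a b => by
    have := halt (a + b)
    simp only [map_add, LinearMap.add_apply, halt] at this
    linear_combination this
  constructor
  · rintro ⟨V₁, V₂, V₃, d₁, -, d₃, h₁₂, h₂₃, -, hV₃, hψ⟩
    obtain ⟨⟨e, he⟩, he0, hspan⟩ := finrank_eq_one_iff'.1 d₁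
    have he0 : e ≠ 0 := fun H => he0 (Subtype.ext H)
    have hV₁ : ∀ v ∈ V₁, ∃ c : F, c • e = v := fun v hv => by
      obtain ⟨c, hc⟩ := hspan ⟨v, hv⟩
      exact ⟨c, congrArg Subtype.val hc⟩
    have heV₃ : ∀ w, h e w = 0 → w ∈ V₃ := fun w hw => (hV₃ w).2 fun v hv => by
      obtain ⟨c, rfl⟩ := hV₁ v hv
      simp [hw]
    refine ⟨e, he0, ?_⟩
    by_contra hne
    obtain ⟨u, huV₃, huV₁⟩ : ∃ u ∈ V₃, u ∉ V₁ := by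
      by_contra! H
      have := Submodule.finrank_mono (show V₃ ≤ V₁ from H)
      omega
    obtain ⟨w, hew, huw⟩ := exists_orthogonal_pairing_ne_zero hnd (e := e) (u := u)
      (fun c hc => huV₁ (hc ▸ V₁.smul_mem c he)) he0
    obtain ⟨x, -, -, hx⟩ := hψnt
    have huV₃' := V₃.smul_mem (x / (h u w * h e (β e))) huV₃
    set f := (x / (h u w * h e (β e))) • u with hf
    have H := hψ _ _
      (inFlagUnipotent_id_add_symmetricTransvection halt h₁₂ h₂₃ hV₃ he huV₃' hV₁)
      (inFlagUnipotent_id_add_symmetricTransvection halt h₁₂ h₂₃ hV₃ he (heV₃ w hew) hV₁)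
    rw [comp_sub_id_eq, map_add, map_add, hψadd, hψadd, add_sub_cancel_left,
      add_sub_cancel_left] at H
    have htr : β ∘ₗ (symmetricTransvection h e f ∘ₗ symmetricTransvection h e w) =
        (h e).smulRight (h f w • β e) := by
      have hfe : h f e = 0 := by rw [hneg, (hV₃ f).1 huV₃' e he, neg_zero]
      ext v
      simp [symmetricTransvection_apply, hfe, halt, hew, smul_smul]
    have hx' : LinearMap.trace F V ((h e).smulRight (h f w • β e)) = x := by
      rw [LinearMap.trace_smulRight, hf]
      simp only [map_smul, LinearMap.smul_apply, smul_eq_mul]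
      field_simp
    rw [htr, hx'] at H
    have hψne : ∀ y, ψ y ≠ 0 := fun y hy => by
      have := hψadd y (-y)
      rw [add_neg_cancel, hψ0, hy, zero_mul] at this
      exact one_ne_zero this
    exact hx (mul_left_cancel₀ (mul_ne_zero (hψne _) (hψne _)) (H.trans (mul_one _).symm))
  · rintro ⟨v, hv, hvβ⟩
    have dker : Module.finrank F (LinearMap.ker (h v)) = 3 := by
      have := Module.Dual.finrank_ker_add_one_of_ne_zero (f := h v) fun H => hv (hnd v (by simp [H]))
      omega
    obtain ⟨u, hvu, hu, c, d, hcd⟩ : ∃ u, h v u = 0 ∧ (∀ a : F, a • v ≠ u) ∧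
        ∃ c d : F, c • v + d • u = β v := by
      by_cases hβv : ∃ c : F, c • v = β v
      · obtain ⟨c, hc⟩ := hβv
        obtain ⟨u, hu, hu'⟩ : ∃ u ∈ LinearMap.ker (h v), u ∉ Submodule.span F {v} := by
          by_contra! H
          have := Submodule.finrank_mono (show LinearMap.ker (h v) ≤ Submodule.span F {v} from H)
          rw [finrank_span_singleton hv] at this
          omega
        exact ⟨u, hu, fun a ha => hu' (Submodule.mem_span_singleton.2 ⟨a, ha⟩), c, 0, by simp [hc]⟩
      · push Not at hβv
        exact ⟨β v, hvβ, hβv, 0, 1, by simp⟩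
    have h₁₂ : Submodule.span F {v} ≤ Submodule.span F {v, u} := Submodule.span_mono (by simp)
    have hiso : ∀ x ∈ Submodule.span F {v, u}, ∀ y ∈ Submodule.span F {v, u}, h x y = 0 := by
      intro x hx y hy
      obtain ⟨a, b, rfl⟩ := Submodule.mem_span_pair.1 hx
      obtain ⟨a', b', rfl⟩ := Submodule.mem_span_pair.1 hy
      simp [halt, hvu, hneg u v]
    have hvV₂ : v ∈ Submodule.span F {v, u} := Submodule.subset_span (by simp)
    have hβ₁ : ∀ x ∈ Submodule.span F {v}, β x ∈ Submodule.span F {v, u} := fun x hx => by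
      obtain ⟨a, rfl⟩ := Submodule.mem_span_singleton.1 hx
      rw [map_smul]
      exact Submodule.smul_mem _ _ (Submodule.mem_span_pair.2 ⟨c, d, hcd⟩)
    refine ⟨Submodule.span F {v}, Submodule.span F {v, u}, LinearMap.ker (h v),
      finrank_span_singleton hv, ?_, dker, h₁₂, fun x hx => hiso v hvV₂ x hx, hiso,
      fun w => ⟨fun hw x hx => ?_, fun hw => hw v (Submodule.mem_span_singleton_self v)⟩, ?_⟩
    · have := finrank_span_eq_card ((LinearIndependent.pair_iff' hv).2 hu)
      rwa [Matrix.range_cons_cons_empty, Fintype.card_fin] at this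
    · obtain ⟨a, rfl⟩ := Submodule.mem_span_singleton.1 hx
      simp [LinearMap.mem_ker.1 hw]
    · rintro g g' ⟨-, hg₁, hg₂, hg₃, -⟩ ⟨-, -, hg₂', hg₃', hg₄'⟩
      have hβ₂ : ∀ x ∈ Submodule.span F {v, u}, β x ∈ LinearMap.ker (h v) := fun x hx => by
        rw [LinearMap.mem_ker, ← neg_eq_zero, ← hskew]
        exact hiso _ (hβ₁ v (Submodule.mem_span_singleton_self v)) x hx
      rw [comp_sub_id_eq, map_add, map_add, trace_comp_eq_zero_of_flag _ _ _ hβ₁ hβ₂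
        (fun x hx => sub_eq_zero.2 (hg₁ x hx)) hg₂ hg₃ hg₂' hg₃' hg₄', add_zero, hψadd]
end

section
/- N_{E/F}(β) is a square in F^× if and only if E/F is biquadratic. (Lemma of §3.2.) -/
/-- `E/F` is biquadratic: Galois with group `ℤ/2ℤ × ℤ/2ℤ`. -/
def IsBiquadratic (F E : Type*) [Field F] [Field E] [Algebra F E] : Prop :=
  IsGalois F E ∧ Nonempty ((E ≃ₐ[F] E) ≃* Multiplicative (ZMod 2 × ZMod 2))

open Polynomial in
/-- A quartic minimal polynomial whose root is conjugate to its negative is biquadratic. -/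
theorem exists_quartic_relation {F E : Type*} [Field F] [Field E] [Algebra F E]
    [FiniteDimensional F E] (h2 : (2 : F) ≠ 0) (hdim : Module.finrank F E = 4)
    {σ : E ≃ₐ[F] E} {β : E} (hβskew : σ β = -β) (hβgen : Algebra.adjoin F {β} = ⊤) :
    ∃ c : F, minpoly F β = X ^ 4 + C c * X ^ 2 + C (Algebra.norm F β) := by
  have hint : IsIntegral F β := IsIntegral.of_finite F β
  have hdeg : (minpoly F β).natDegree = 4 := by
    rw [← PowerBasis.ofAdjoinEqTop_dim hint hβgen, ← PowerBasis.finrank, hdim]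
  have heven : minpoly F β = (minpoly F β).comp (-X) := by
    have h := minpoly.neg (A := F) β
    rw [← hβskew, minpoly.algEquiv_eq, hdeg] at h
    simpa [Even.neg_one_pow (by decide : Even 4)] using h
  have hodd (n : ℕ) (hn : Odd n) : (minpoly F β).coeff n = 0 := by
    have h : (minpoly F β).coeff n = (-1) ^ n * (minpoly F β).coeff n := by
      conv_lhs => rw [heven, ← neg_one_mul, ← C_1, ← C_neg, comp_C_mul_X_coeff]
      ring
    rw [hn.neg_one_pow] at h
    have h' : 2 * (minpoly F β).coeff n = 0 := by linear_combination h
    exact (mul_eq_zero.mp h').resolve_left h2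
  have hnorm : Algebra.norm F β = (minpoly F β).coeff 0 := by
    have h := Algebra.PowerBasis.norm_gen_eq_coeff_zero_minpoly (PowerBasis.ofAdjoinEqTop hint hβgen)
    rw [PowerBasis.ofAdjoinEqTop_gen, ← PowerBasis.finrank, hdim] at h
    simpa [Even.neg_one_pow (by decide : Even 4)] using h
  have hlead : (minpoly F β).coeff 4 = 1 := hdeg ▸ (minpoly.monic hint).coeff_natDegree
  refine ⟨(minpoly F β).coeff 2, ?_⟩
  conv_lhs => rw [(minpoly F β).as_sum_range, hdeg]
  simp only [Finset.sum_range_succ, Finset.sum_range_zero, hodd 1 (by decide),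
    hodd 3 (by decide), hlead, hnorm, ← C_mul_X_pow_eq_monomial]
  simp only [map_zero, map_one]
  ring

open Polynomial in
/-- The square of a generator of a quartic extension does not lie in the base field. -/
theorem sq_ne_algebraMap_of_adjoin_eq_top {F E : Type*} [Field F] [Field E] [Algebra F E]
    [FiniteDimensional F E] (hdim : Module.finrank F E = 4)
    {β : E} (hβgen : Algebra.adjoin F {β} = ⊤) (a : F) : β ^ 2 ≠ algebraMap F E a := by
  intro h
  have hint : IsIntegral F β := IsIntegral.of_finite F β
  have hdeg : (minpoly F β).natDegree = 4 := by
    rw [← PowerBasis.ofAdjoinEqTop_dim hint hβgen, ← PowerBasis.finrank, hdim]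
  have hle := natDegree_le_of_dvd (minpoly.dvd F β (p := X ^ 2 - C a) (by simp [h]))
    (X_pow_sub_C_ne_zero two_pos a)
  rw [hdeg, natDegree_X_pow_sub_C] at hle
  omega

open Polynomial in
/-- If the norm of a skew generator of a quartic extension is a square, then the extension is
biquadratic. -/
theorem isBiquadratic_of_norm_eq_sq {F E : Type*} [Field F] [Field E] [Algebra F E]
    [FiniteDimensional F E] (h2 : (2 : F) ≠ 0) (hdim : Module.finrank F E = 4)
    {σ : E ≃ₐ[F] E} {β : E} (hβskew : σ β = -β) (hβgen : Algebra.adjoin F {β} = ⊤)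
    {t : F} (ht : Algebra.norm F β = t ^ 2) : IsBiquadratic F E := by
  classical
  have hint : IsIntegral F β := IsIntegral.of_finite F β
  have hsq := sq_ne_algebraMap_of_adjoin_eq_top hdim hβgen
  have hβ0 : β ≠ 0 := fun h => hsq 0 (by simp [h])
  have h2E : (2 : E) ≠ 0 := by
    simpa only [map_ofNat] using (map_ne_zero (algebraMap F E)).mpr h2
  obtain ⟨c, hc⟩ := exists_quartic_relation h2 hdim hβskew hβgen
  rw [ht] at hc
  set s : E := algebraMap F E t with hs
  set d : E := algebraMap F E c with hd
  have haeval (x : E) : aeval x (minpoly F β) = x ^ 4 + d * x ^ 2 + s ^ 2 := by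
    simp [hc, hs, hd]
  have hβ : β ^ 4 + d * β ^ 2 + s ^ 2 = 0 := by rw [← haeval, minpoly.aeval]
  have hroot : aeval (s / β) (minpoly F β) = 0 := by
    rw [haeval]
    field_simp
    linear_combination s ^ 2 * hβ
  let τ : E ≃ₐ[F] E := AlgEquiv.ofBijective
    ((PowerBasis.ofAdjoinEqTop hint hβgen).lift (s / β) hroot)
    (Algebra.IsAlgebraic.algHom_bijective _)
  have hτ : τ β = s / β := (PowerBasis.ofAdjoinEqTop hint hβgen).lift_gen (s / β) hroot
  have hs0 : s ≠ 0 := fun h => hβ0 (τ.injective (by rw [hτ, h, zero_div, map_zero]))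
  have hfix (φ : E ≃ₐ[F] E) : φ s = s := φ.commutes t
  have hext {φ ψ : E ≃ₐ[F] E} (h : φ β = ψ β) : φ = ψ := by
    apply AlgEquiv.coe_toAlgHom_injective
    exact AlgHom.ext_of_adjoin_eq_top hβgen (by simpa using h)
  have hne : β ≠ -β := fun h =>
    (mul_ne_zero h2E hβ0) (by linear_combination h)
  have hne1 : s / β ≠ β := fun h => hsq t (by
    rw [div_eq_iff hβ0] at h; linear_combination -h)
  have hne2 : s / β ≠ -β := fun h => hsq (-t) (by
    rw [div_eq_iff hβ0] at h; rw [map_neg]; linear_combination h)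
  have hconj (φ : E ≃ₐ[F] E) : φ β = β ∨ φ β = -β ∨ φ β = s / β ∨ φ β = -(s / β) := by
    have h : (φ β) ^ 4 + d * (φ β) ^ 2 + s ^ 2 = 0 := by
      simpa [hs, hd] using congrArg φ hβ
    have h' : (φ β - β) * ((φ β + β) * ((φ β - s / β) * (φ β + s / β))) = 0 := by
      field_simp
      linear_combination β ^ 2 * h - (φ β) ^ 2 * hβ
    simpa [sub_eq_zero, add_eq_zero_iff_eq_neg] using h'
  have hinv (φ : E ≃ₐ[F] E) : φ ^ 2 = 1 := by
    apply hext
    rw [pow_two, AlgEquiv.mul_apply, AlgEquiv.one_apply]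
    have hφs := hfix φ
    rcases hconj φ with h | h | h | h <;> simp only [h, map_neg, map_div₀, hφs, neg_neg] <;>
      field_simp
  have hcard : Nat.card (E ≃ₐ[F] E) = 4 := by
    apply le_antisymm
    · rw [Nat.card_eq_fintype_card, ← hdim]
      exact AlgEquiv.card_le
    · have h4 : ({1, σ, τ, σ * τ} : Finset (E ≃ₐ[F] E)).card = 4 := by
        have hστ : (σ * τ) β = -(s / β) := by
          rw [AlgEquiv.mul_apply, hτ, map_div₀, hfix σ, hβskew, div_neg]
        have hval {φ ψ : E ≃ₐ[F] E} (h : φ β ≠ ψ β) : φ ≠ ψ := fun h' => h (by rw [h'])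
        have h₁ : (1 : E ≃ₐ[F] E) ∉ ({σ, τ, σ * τ} : Finset (E ≃ₐ[F] E)) := by
          simp only [Finset.mem_insert, Finset.mem_singleton, not_or]
          refine ⟨hval ?_, hval ?_, hval ?_⟩
          · rwa [hβskew]
          · rw [hτ]; exact hne1.symm
          · rw [hστ]; exact fun h => hne2 (eq_neg_iff_add_eq_zero.mpr
              (by rw [AlgEquiv.one_apply] at h; linear_combination h))
        have h₂ : σ ∉ ({τ, σ * τ} : Finset (E ≃ₐ[F] E)) := by
          simp only [Finset.mem_insert, Finset.mem_singleton, not_or]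
          refine ⟨hval ?_, hval ?_⟩
          · rw [hβskew, hτ]; exact hne2.symm
          · rw [hβskew, hστ]; exact fun h => hne1 (neg_injective h).symm
        have h₃ : τ ≠ σ * τ := hval (by
          rw [hτ, hστ]
          exact fun h => mul_ne_zero h2E (div_ne_zero hs0 hβ0) (by linear_combination h))
        rw [Finset.card_insert_of_notMem h₁, Finset.card_insert_of_notMem h₂,
          Finset.card_pair h₃]
      rw [Nat.card_eq_fintype_card, ← h4]
      exact Finset.card_le_univ _
  have : IsKleinFour (E ≃ₐ[F] E) := by
    refine ⟨hcard, ?_⟩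
    have : Nontrivial (E ≃ₐ[F] E) := Finite.one_lt_card_iff_nontrivial.mp (by omega)
    exact (Monoid.exponent_eq_prime_iff Nat.prime_two).mpr
      fun φ hφ => orderOf_eq_prime (hinv φ) hφ
  exact ⟨IsGalois.of_card_aut_eq_finrank F E (hcard.trans hdim.symm),
    IsKleinFour.nonempty_mulEquiv⟩

/-- In a biquadratic extension, the norm of an element that is negated by some automorphism is a
square. -/
theorem IsBiquadratic.exists_norm_eq_sq {F E : Type*} [Field F] [Field E] [Algebra F E]
    [FiniteDimensional F E] (hE : IsBiquadratic F E)
    {σ : E ≃ₐ[F] E} (hσ : σ ≠ 1) {β : E} (hβskew : σ β = -β) :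
    ∃ t : F, Algebra.norm F β = t ^ 2 := by
  classical
  obtain ⟨hgal, ⟨e⟩⟩ := hE
  have : IsKleinFour (E ≃ₐ[F] E) :=
    ⟨(Nat.card_congr e.toEquiv).trans IsKleinFour.card_four,
      (Monoid.exponent_eq_of_mulEquiv e).trans IsKleinFour.exponent_two⟩
  obtain ⟨τ, hτ⟩ : ∃ τ : E ≃ₐ[F] E, τ ∉ ({1, σ} : Finset (E ≃ₐ[F] E)) := by
    by_contra! h
    have h' := Finset.card_le_card (fun φ _ => h φ : Finset.univ ⊆ {1, σ})
    rw [Finset.card_univ, IsKleinFour.card_four'] at h'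
    have := Finset.card_le_two (a := 1) (b := σ)
    omega
  simp only [Finset.mem_insert, Finset.mem_singleton, not_or] at hτ
  have huniv := IsKleinFour.eq_finset_univ hτ.1 hσ hτ.2
  have hττ : τ (τ β) = β := DFunLike.congr_fun (IsKleinFour.mul_self τ) β
  have hcomm : σ (τ β) = τ (σ β) :=
    DFunLike.congr_fun (IsKleinFour.isMulCommutative.is_comm.comm σ τ) β
  have hfix (φ : E ≃ₐ[F] E) : φ (β * τ β) = β * τ β := by
    have hφ : φ ∈ ({τ * σ, τ, σ, 1} : Finset (E ≃ₐ[F] E)) := huniv ▸ Finset.mem_univ φ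
    simp only [Finset.mem_insert, Finset.mem_singleton] at hφ
    rcases hφ with rfl | rfl | rfl | rfl <;>
      simp [hcomm, hττ, hβskew, mul_comm]
  obtain ⟨t, ht⟩ := (IsGalois.mem_range_algebraMap_iff_fixed _).mpr hfix
  refine ⟨t, (algebraMap F E).injective ?_⟩
  have hprod : ∏ φ : E ≃ₐ[F] E, φ β = (τ * σ) β * (τ β * (σ β * β)) := by
    have hmem : τ * σ ∉ ({τ, σ, 1} : Finset (E ≃ₐ[F] E)) := by
      simpa using mul_notMem_of_exponent_two IsKleinFour.exponent_two hτ.1 hσ hτ.2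
    rw [← huniv, Finset.prod_insert hmem, Finset.prod_insert (by simp [hτ]),
      Finset.prod_pair hσ, AlgEquiv.one_apply]
  rw [Algebra.norm_eq_prod_automorphisms, hprod, map_pow, ht]
  simp only [AlgEquiv.mul_apply, hβskew, map_neg]
  ring

/-- Lemma of §3.2.
Let `E/F` be a degree-4 extension of the nonarchimedean local field `F` of odd
residual characteristic, `σ` an `F`-automorphism of `E` of order 2 (whose fixed
field is the intermediate quadratic subfield `E₀`), and `β ∈ E` with
`σ(β) = −β` and `F[β] = E`.  Then `N_{E/F}(β)` is a square in `F^×` iff `E/F`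
is biquadratic. -/
theorem norm_square_iff_biquadratic
    {F E : Type*} [Field F] [Field E] [Algebra F E] [FiniteDimensional F E]
    (ν : F → ℤ) (hF : IsNALocalField ν) (hodd : OddResidualChar ν)
    (hdim : Module.finrank F E = 4)
    (σ : E ≃ₐ[F] E) (hσ2 : ∀ x : E, σ (σ x) = x)
    (hσne : σ ≠ (AlgEquiv.refl : E ≃ₐ[F] E))
    (β : E) (hβskew : σ β = -β) (hβgen : Algebra.adjoin F {β} = ⊤) :
    (∃ t : F, Algebra.norm F β = t ^ 2) ↔ IsBiquadratic F E := by
  constructor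
  · rintro ⟨t, ht⟩
    exact isBiquadratic_of_norm_eq_sq hodd.1 hdim hβskew hβgen ht
  · exact fun hE => hE.exists_norm_eq_sq hσne hβskew
end

section
/- Assume that E/F is biquadratic (equivalently, that N_{E/F}(β) is a square in F^×). Then N_{E/E₀}(E^×) = F^× · (E₀^×)², and consequently N_{E/F}(E^×) = (F^×)². (Lemma of §3.2, second assertion.) -/
/-- `x` has valuation at least `N`, where `0` has infinite valuation. -/
def ValGE {K : Type*} [Field K] (ν : K → ℤ) (N : ℤ) (x : K) : Prop := x = 0 ∨ N ≤ ν x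

namespace IsNALocalField

variable {K : Type*} [Field K] {ν : K → ℤ}

theorem map_one (h : IsNALocalField ν) : ν 1 = 0 := by
  have := h.map_mul 1 1 one_ne_zero one_ne_zero
  rw [mul_one] at this
  omega

theorem map_neg_one (h : IsNALocalField ν) : ν (-1) = 0 := by
  have := h.map_mul (-1) (-1) (by simp) (by simp)
  rw [neg_mul_neg, mul_one, h.map_one] at this
  omega

theorem map_neg (h : IsNALocalField ν) (x : K) : ν (-x) = ν x := by
  rcases eq_or_ne x 0 with rfl | hx
  · simp
  · rw [← neg_one_mul, h.map_mul _ _ (by simp) hx, h.map_neg_one, zero_add]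

theorem map_inv (h : IsNALocalField ν) {x : K} (hx : x ≠ 0) : ν x⁻¹ = -ν x := by
  have := h.map_mul x x⁻¹ hx (inv_ne_zero hx)
  rw [mul_inv_cancel₀ hx, h.map_one] at this
  omega

theorem map_div (h : IsNALocalField ν) {x y : K} (hx : x ≠ 0) (hy : y ≠ 0) :
    ν (x / y) = ν x - ν y := by
  rw [div_eq_mul_inv, h.map_mul _ _ hx (inv_ne_zero hy), h.map_inv hy]
  ring

theorem map_sq (h : IsNALocalField ν) {x : K} (hx : x ≠ 0) : ν (x ^ 2) = 2 * ν x := by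
  rw [pow_two, h.map_mul _ _ hx hx]
  ring

theorem valGE_add (h : IsNALocalField ν) {N : ℤ} {x y : K} (hx : ValGE ν N x)
    (hy : ValGE ν N y) : ValGE ν N (x + y) := by
  rcases eq_or_ne x 0 with rfl | hx0
  · rwa [zero_add]
  rcases eq_or_ne y 0 with rfl | hy0
  · rwa [add_zero]
  rcases eq_or_ne (x + y) 0 with h0 | h0
  · exact .inl h0
  · exact .inr ((le_min (hx.resolve_left hx0) (hy.resolve_left hy0)).trans
      (h.ultrametric x y hx0 hy0 h0))

theorem valGE_neg (h : IsNALocalField ν) {N : ℤ} {x : K} (hx : ValGE ν N x) :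
    ValGE ν N (-x) := by
  simpa only [ValGE, neg_eq_zero, h.map_neg] using hx

theorem valGE_sub (h : IsNALocalField ν) {N : ℤ} {x y : K} (hx : ValGE ν N x)
    (hy : ValGE ν N y) : ValGE ν N (x - y) := by
  rw [sub_eq_add_neg]
  exact h.valGE_add hx (h.valGE_neg hy)

theorem valGE_mul (h : IsNALocalField ν) {M N : ℤ} {x y : K} (hx : ValGE ν M x)
    (hy : ValGE ν N y) : ValGE ν (M + N) (x * y) := by
  rcases eq_or_ne x 0 with rfl | hx0
  · exact .inl (zero_mul _)
  rcases eq_or_ne y 0 with rfl | hy0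
  · exact .inl (mul_zero _)
  · exact .inr ((add_le_add (hx.resolve_left hx0) (hy.resolve_left hy0)).trans
      (h.map_mul x y hx0 hy0).ge)

end IsNALocalField

theorem ValGE.mono {K : Type*} [Field K] {ν : K → ℤ} {M N : ℤ} {x : K}
    (hx : ValGE ν N x) (hMN : M ≤ N) : ValGE ν M x :=
  hx.imp_right hMN.trans

theorem ValGE.eq_zero_of_forall {K : Type*} [Field K] {ν : K → ℤ} {x : K}
    (hx : ∀ N, ValGE ν N x) : x = 0 :=
  (hx (ν x + 1)).resolve_right (by omega)

namespace IsNALocalField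

variable {K : Type*} [Field K] {ν : K → ℤ}

theorem not_valGE_one_one (h : IsNALocalField ν) : ¬ ValGE ν 1 (1 : K) := by
  rintro (h1 | h1)
  · exact one_ne_zero h1
  · rw [h.map_one] at h1
    omega

theorem valGE_half (h : IsNALocalField ν) (hodd : OddResidualChar ν) {N : ℤ} {x : K}
    (hx : ValGE ν N x) : ValGE ν N (x / 2) := by
  have h2 : ValGE ν 0 (2 : K)⁻¹ := .inr (by rw [h.map_inv hodd.1, hodd.2]; simp)
  simpa [div_eq_mul_inv] using h.valGE_mul hx h2

/-- Hensel's lemma for squares: principal units are squares. -/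
theorem isSquare_of_valGE_sub_one (h : IsNALocalField ν) (hodd : OddResidualChar ν) {c : K}
    (hc : ValGE ν 1 (c - 1)) : IsSquare c := by
  let f : K → K := fun w => ((c - 1) - w ^ 2) / 2
  let w : ℕ → K := fun n => f^[n] 0
  have hws (n : ℕ) : w (n + 1) = ((c - 1) - w n ^ 2) / 2 :=
    Function.iterate_succ_apply' f n 0
  have hw1 (n : ℕ) : ValGE ν 1 (w n) := by
    induction n with
    | zero => exact .inl rfl
    | succ n ih =>
      rw [hws, pow_two]
      exact h.valGE_half hodd (h.valGE_sub hc ((h.valGE_mul ih ih).mono (by norm_num)))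
  have h2 := hodd.1
  have hstep (n : ℕ) : ValGE ν n (w (n + 1) - w n) := by
    induction n with
    | zero => exact (h.valGE_sub (hw1 _) (hw1 _)).mono (by simp)
    | succ n ih =>
      have : w (n + 1 + 1) - w (n + 1) = -((w (n + 1) - w n) * (w (n + 1) + w n) / 2) := by
        rw [hws (n + 1)]
        nth_rewrite 2 [hws n]
        field_simp
        ring
      rw [this]
      exact h.valGE_neg (h.valGE_half hodd
        (by exact_mod_cast h.valGE_mul ih (h.valGE_add (hw1 (n + 1)) (hw1 n))))
  have hcauchy (M k : ℕ) : ValGE ν M (w (M + k) - w M) := by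
    induction k with
    | zero => exact .inl (by simp)
    | succ k ih =>
      have : w (M + (k + 1)) - w M = (w (M + k + 1) - w (M + k)) + (w (M + k) - w M) := by
        rw [← add_assoc]
        ring
      rw [this]
      exact h.valGE_add ((hstep (M + k)).mono (by simp)) ih
  obtain ⟨L, hL⟩ := h.complete w fun N => ⟨N.toNat, fun m hm n hn => by
    have key : ValGE ν N (w m - w n) := by
      obtain ⟨k, rfl⟩ := Nat.exists_eq_add_of_le hm
      obtain ⟨l, rfl⟩ := Nat.exists_eq_add_of_le hn
      have := h.valGE_sub (hcauchy N.toNat k) (hcauchy N.toNat l)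
      rw [sub_sub_sub_cancel_right] at this
      exact this.mono (Int.self_le_toNat N)
    exact key.imp_left sub_eq_zero.mp⟩
  have hL' (N : ℤ) : ∃ M : ℕ, ∀ m ≥ M, ValGE ν N (w m - L) := by
    obtain ⟨M, hM⟩ := hL N
    exact ⟨M, fun m hm => (hM m hm).imp_left sub_eq_zero.mpr⟩
  have hL1 : ValGE ν 1 L := by
    obtain ⟨M, hM⟩ := hL' 1
    have := h.valGE_sub (hw1 M) (hM M le_rfl)
    rwa [sub_sub_cancel] at this
  have hfix : (c - 1) - L ^ 2 - 2 * L = 0 := by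
    refine ValGE.eq_zero_of_forall (ν := ν) fun N => ?_
    obtain ⟨M, hM⟩ := hL' N
    have h2' : ValGE ν 0 (2 : K) := .inr hodd.2.ge
    have e : (c - 1) - L ^ 2 - 2 * L
        = 2 * (w (M + 1) - L) + (w M - L) * (w M + L) := by
      rw [hws]
      field_simp
      ring
    rw [e]
    refine h.valGE_add ?_ ?_
    · simpa using h.valGE_mul h2' (hM (M + 1) (Nat.le_succ M))
    · exact (h.valGE_mul (hM M le_rfl) (h.valGE_add (hw1 M) hL1)).mono (by simp)
  exact ⟨1 + L, by linear_combination hfix⟩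

/-- The valuation ring. -/
def integers (h : IsNALocalField ν) : ValuationSubring K where
  carrier := {x | ValGE ν 0 x}
  mul_mem' hx hy := by simpa using h.valGE_mul hx hy
  one_mem' := .inr h.map_one.ge
  add_mem' := h.valGE_add
  zero_mem' := .inl rfl
  neg_mem' := h.valGE_neg
  mem_or_inv_mem' x := by
    rcases eq_or_ne x 0 with rfl | hx
    · exact .inl (.inl rfl)
    · rcases le_total 0 (ν x) with h0 | h0
      · exact .inl (.inr h0)
      · exact .inr (.inr (by rw [h.map_inv hx]; omega))

theorem residue_eq_zero_iff (h : IsNALocalField ν) (x : h.integers) :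
    IsLocalRing.residue h.integers x = 0 ↔ ValGE ν 1 (x : K) := by
  rw [IsLocalRing.residue_eq_zero_iff, IsLocalRing.mem_maximalIdeal, mem_nonunits_iff]
  have hx : ValGE ν 0 (x : K) := x.2
  constructor
  · intro hu
    by_contra hx1
    have hx0 : (x : K) ≠ 0 := fun h0 => hx1 (.inl h0)
    have hν : ν (x : K) = 0 := by
      have h1 := hx.resolve_left hx0
      have h2 : ¬ 1 ≤ ν (x : K) := fun h2 => hx1 (.inr h2)
      omega
    refine hu (IsUnit.of_mul_eq_one
      (⟨(x : K)⁻¹, .inr (by rw [h.map_inv hx0, hν]; simp)⟩ : h.integers) ?_)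
    exact Subtype.ext (mul_inv_cancel₀ hx0)
  · intro hx1 hu
    obtain ⟨y, hy⟩ := hu.exists_right_inv
    have hy0 : ValGE ν 0 (y : K) := y.2
    have := h.valGE_mul hx1 hy0
    have hxy : (x : K) * y = 1 := congrArg Subtype.val hy
    rw [hxy] at this
    exact h.not_valGE_one_one this

theorem finite_residueField (h : IsNALocalField ν) :
    Finite (IsLocalRing.ResidueField h.integers) := by
  classical
  obtain ⟨S, hS⟩ := h.finiteResidue
  let g : S → IsLocalRing.ResidueField h.integers := fun y =>
    if hy : ValGE ν 0 (y : K) then IsLocalRing.residue h.integers ⟨y, hy⟩ else 0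
  refine Finite.of_surjective g fun r => ?_
  obtain ⟨x, rfl⟩ := IsLocalRing.residue_surjective r
  obtain ⟨y, hyS, hy⟩ := hS x x.2
  have hxy : ValGE ν 1 ((x : K) - y) := hy.imp sub_eq_zero.mpr id
  have hx0 : ValGE ν 0 (x : K) := x.2
  have hy0 : ValGE ν 0 y := by
    have := h.valGE_sub hx0 (hxy.mono zero_le_one)
    rwa [sub_sub_cancel] at this
  refine ⟨⟨y, hyS⟩, ?_⟩
  simp only [g, dif_pos hy0]
  rw [← sub_eq_zero, ← map_sub, h.residue_eq_zero_iff]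
  have := h.valGE_neg hxy
  rwa [neg_sub] at this

/-- A unit whose residue is a square is a square. -/
theorem isSquare_of_isSquare_residue (h : IsNALocalField ν) (hodd : OddResidualChar ν)
    (x : h.integers) (hx : ¬ ValGE ν 1 (x : K))
    (hs : IsSquare (IsLocalRing.residue h.integers x)) : IsSquare (x : K) := by
  obtain ⟨r, hr⟩ := hs
  obtain ⟨y, rfl⟩ := IsLocalRing.residue_surjective r
  rw [← _root_.map_mul, ← sub_eq_zero, ← map_sub, h.residue_eq_zero_iff] at hr
  have hr' : ValGE ν 1 ((x : K) - y * y) := hr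
  have hy : ValGE ν 0 (y : K) := y.2
  have hy1 : ¬ ValGE ν 1 (y : K) := fun hy1 => hx (by
    have := h.valGE_add hr' ((h.valGE_mul hy1 hy1).mono (by norm_num))
    rwa [sub_add_cancel] at this)
  have hy0 : (y : K) ≠ 0 := fun h0 => hy1 (.inl h0)
  have hν : ν (y : K) = 0 := by
    have h1 := hy.resolve_left hy0
    have h2 : ¬ 1 ≤ ν (y : K) := fun h2 => hy1 (.inr h2)
    omega
  have hi : ValGE ν 0 ((y : K)⁻¹ * (y : K)⁻¹) :=
    .inr (by rw [h.map_mul _ _ (inv_ne_zero hy0) (inv_ne_zero hy0), h.map_inv hy0, hν]; simp)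
  have hq : ValGE ν 1 ((x : K) / (y * y) - 1) := by
    have := h.valGE_mul hr' hi
    have e : (x : K) / (y * y) - 1 = ((x : K) - y * y) * ((y : K)⁻¹ * (y : K)⁻¹) := by
      field_simp
    rw [e]
    simpa using this
  have := (h.isSquare_of_valGE_sub_one hodd hq).mul (IsSquare.mul_self (y : K))
  rwa [div_mul_cancel₀ _ (mul_ne_zero hy0 hy0)] at this

theorem isSquare_mul_of_map_eq_zero (h : IsNALocalField ν) (hodd : OddResidualChar ν) {a b : K}
    (ha0 : a ≠ 0) (hb0 : b ≠ 0) (ha : ν a = 0) (hb : ν b = 0)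
    (hsa : ¬ IsSquare a) (hsb : ¬ IsSquare b) : IsSquare (a * b) := by
  classical
  have := h.finite_residueField
  have := Fintype.ofFinite (IsLocalRing.ResidueField h.integers)
  let a' : h.integers := ⟨a, .inr ha.ge⟩
  let b' : h.integers := ⟨b, .inr hb.ge⟩
  have hu {x : K} (hx0 : x ≠ 0) (hx : ν x = 0) : ¬ ValGE ν 1 x := by
    rintro (h1 | h1)
    · exact hx0 h1
    · omega
  have hab : ¬ ValGE ν 1 (a * b) :=
    hu (mul_ne_zero ha0 hb0) (by rw [h.map_mul _ _ ha0 hb0, ha, hb, add_zero])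
  have hra : quadraticChar _ (IsLocalRing.residue h.integers a') = -1 :=
    quadraticChar_neg_one_iff_not_isSquare.mpr fun hs =>
      hsa (h.isSquare_of_isSquare_residue hodd a' (hu ha0 ha) hs)
  have hrb : quadraticChar _ (IsLocalRing.residue h.integers b') = -1 :=
    quadraticChar_neg_one_iff_not_isSquare.mpr fun hs =>
      hsb (h.isSquare_of_isSquare_residue hodd b' (hu hb0 hb) hs)
  refine h.isSquare_of_isSquare_residue hodd (a' * b') hab ?_
  refine (quadraticChar_one_iff_isSquare ?_).mp ?_
  · rwa [Ne, h.residue_eq_zero_iff]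
  · rw [_root_.map_mul, _root_.map_mul, hra, hrb]
    norm_num

theorem isSquare_mul_sq_iff {a s : K} (hs : s ≠ 0) : IsSquare (a * s ^ 2) ↔ IsSquare a := by
  refine ⟨fun hsq => ?_, fun hsq => hsq.mul (IsSquare.sq s)⟩
  have := hsq.div (IsSquare.sq s)
  rwa [mul_div_cancel_right₀ _ (pow_ne_zero 2 hs)] at this

theorem exists_map_mul_sq_eq_zero (h : IsNALocalField ν) {a : K} (ha0 : a ≠ 0)
    (ha : Even (ν a)) : ∃ s : K, s ≠ 0 ∧ ν (a * s ^ 2) = 0 := by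
  obtain ⟨k, hk⟩ := ha
  obtain ⟨s, hs0, hs⟩ := h.surj (-k)
  refine ⟨s, hs0, ?_⟩
  rw [h.map_mul _ _ ha0 (pow_ne_zero 2 hs0), h.map_sq hs0]
  omega

/-- Nonsquares of even valuation lie in a single square class. -/
theorem isSquare_mul_of_even (h : IsNALocalField ν) (hodd : OddResidualChar ν) {a b : K}
    (ha0 : a ≠ 0) (hb0 : b ≠ 0) (ha : Even (ν a)) (hb : Even (ν b))
    (hsa : ¬ IsSquare a) (hsb : ¬ IsSquare b) : IsSquare (a * b) := by
  obtain ⟨s, hs0, hs⟩ := h.exists_map_mul_sq_eq_zero ha0 ha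
  obtain ⟨t, ht0, ht⟩ := h.exists_map_mul_sq_eq_zero hb0 hb
  have := h.isSquare_mul_of_map_eq_zero hodd (mul_ne_zero ha0 (pow_ne_zero 2 hs0))
    (mul_ne_zero hb0 (pow_ne_zero 2 ht0)) hs ht ((isSquare_mul_sq_iff hs0).not.mpr hsa)
    ((isSquare_mul_sq_iff ht0).not.mpr hsb)
  rw [show a * s ^ 2 * (b * t ^ 2) = a * b * (s * t) ^ 2 by ring] at this
  exact (isSquare_mul_sq_iff (mul_ne_zero hs0 ht0)).mp this

theorem exists_sq_add_sq_eq_neg_one (h : IsNALocalField ν) (hodd : OddResidualChar ν) :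
    ∃ x y : K, x ^ 2 + y ^ 2 = -1 := by
  have := h.finite_residueField
  have : NeZero (ringChar (IsLocalRing.ResidueField h.integers)) :=
    ⟨CharP.ringChar_ne_zero_of_finite _⟩
  obtain ⟨a, b, hab⟩ := CharP.sq_add_sq (IsLocalRing.ResidueField h.integers)
    (ringChar (IsLocalRing.ResidueField h.integers)) (-1)
  have hN (n : ℕ) : ValGE ν 0 (n : K) := (n : h.integers).2
  have hab' : ValGE ν 1 ((a : K) ^ 2 + (b : K) ^ 2 + 1) := by
    have := (h.residue_eq_zero_iff ((a : h.integers) ^ 2 + (b : h.integers) ^ 2 + 1)).mp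
      (by simp [hab])
    exact_mod_cast this
  have key (a b : ℕ) (hab' : ValGE ν 1 ((a : K) ^ 2 + (b : K) ^ 2 + 1))
      (ha1 : ¬ ValGE ν 1 (a : K)) : ∃ x y : K, x ^ 2 + y ^ 2 = -1 := by
    have ha0 : (a : K) ≠ 0 := fun h0 => ha1 (.inl h0)
    have hν : ν (a : K) = 0 := by
      have h1 := (hN a).resolve_left ha0
      have h2 : ¬ 1 ≤ ν (a : K) := fun h2 => ha1 (.inr h2)
      omega
    have hi : ValGE ν 0 ((a : K) ^ 2)⁻¹ :=
      .inr (by rw [h.map_inv (pow_ne_zero 2 ha0), h.map_sq ha0, hν]; simp)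
    have hq : ValGE ν 1 (-(1 + (b : K) ^ 2) / (a : K) ^ 2 - 1) := by
      have e : -(1 + (b : K) ^ 2) / (a : K) ^ 2 - 1
          = -(((a : K) ^ 2 + (b : K) ^ 2 + 1) * ((a : K) ^ 2)⁻¹) := by
        field_simp
        ring
      rw [e]
      simpa using h.valGE_neg (h.valGE_mul hab' hi)
    obtain ⟨r, hr⟩ := h.isSquare_of_valGE_sub_one hodd hq
    refine ⟨a * r, b, ?_⟩
    field_simp at hr
    linear_combination -hr
  by_cases ha1 : ValGE ν 1 (a : K)
  · by_cases hb1 : ValGE ν 1 (b : K)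
    · refine absurd ?_ h.not_valGE_one_one
      have h2 := h.valGE_add ((h.valGE_mul ha1 ha1).mono (by norm_num : (1 : ℤ) ≤ 1 + 1))
        ((h.valGE_mul hb1 hb1).mono (by norm_num : (1 : ℤ) ≤ 1 + 1))
      have := h.valGE_sub hab' h2
      rwa [show (a : K) ^ 2 + (b : K) ^ 2 + 1 - (a * a + b * b) = 1 by ring] at this
    · exact key b a (by rwa [add_comm ((b : K) ^ 2)]) hb1
  · exact key a b hab' ha1

theorem map_one_sub_of_pos (h : IsNALocalField ν) {c : K} (hc0 : c ≠ 0) (hc1 : 1 - c ≠ 0)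
    (hc : 0 < ν c) : ν (1 - c) = 0 := by
  have h1 := h.ultrametric 1 (-c) one_ne_zero (neg_ne_zero.mpr hc0) (by rwa [← sub_eq_add_neg])
  have h2 := h.ultrametric (1 - c) c hc1 hc0 (by simp)
  rw [h.map_neg, ← sub_eq_add_neg, h.map_one] at h1
  rw [sub_add_cancel, h.map_one] at h2
  rw [min_def] at h1 h2
  split_ifs at h1 h2 <;> omega

theorem map_one_sub_of_neg (h : IsNALocalField ν) {c : K} (hc0 : c ≠ 0) (hc1 : 1 - c ≠ 0)
    (hc : ν c < 0) : ν (1 - c) = ν c := by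
  have e : 1 - c = c * -(1 - c⁻¹) := by
    field_simp
    ring
  have hi : 1 - c⁻¹ ≠ 0 := by
    intro h0
    rw [e, h0] at hc1
    simp at hc1
  rw [e, h.map_mul _ _ hc0 (neg_ne_zero.mpr hi), h.map_neg,
    h.map_one_sub_of_pos (inv_ne_zero hc0) hi (by rw [h.map_inv hc0]; omega), add_zero]

/-- Norms from the unramified quadratic extension have even valuation. -/
theorem even_map_sq_sub_mul_sq (h : IsNALocalField ν) (hodd : OddResidualChar ν) {e x y : K}
    (he : Even (ν e)) (hse : ¬ IsSquare e) (hn : x ^ 2 - e * y ^ 2 ≠ 0) :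
    Even (ν (x ^ 2 - e * y ^ 2)) := by
  have he0 : e ≠ 0 := by
    rintro rfl
    exact hse (IsSquare.zero)
  rcases eq_or_ne y 0 with rfl | hy
  · have hx : x ≠ 0 := by
      rintro rfl
      simp at hn
    simp [h.map_sq hx]
  have hey : e * y ^ 2 ≠ 0 := mul_ne_zero he0 (pow_ne_zero 2 hy)
  have heven : Even (ν (e * y ^ 2)) := by
    rw [h.map_mul _ _ he0 (pow_ne_zero 2 hy), h.map_sq hy]
    exact he.add (even_two_mul _)
  rcases eq_or_ne x 0 with rfl | hx
  · simpa [h.map_neg] using heven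
  set c := e * y ^ 2 / x ^ 2 with hc
  have hx2 := pow_ne_zero 2 hx
  have hc0 : c ≠ 0 := div_ne_zero hey hx2
  have hfac : x ^ 2 - e * y ^ 2 = x ^ 2 * (1 - c) := by
    rw [hc]
    field_simp
  have hc1 : 1 - c ≠ 0 := by
    intro h0
    rw [hfac, h0, mul_zero] at hn
    exact hn rfl
  have hcs : ¬ IsSquare c := by
    have : c = e * (y / x) ^ 2 := by
      rw [hc]
      field_simp
    rwa [this, isSquare_mul_sq_iff (div_ne_zero hy hx)]
  have hce : Even (ν c) := by
    rw [hc, h.map_div hey hx2, h.map_sq hx]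
    exact heven.sub (even_two_mul _)
  rw [hfac, h.map_mul _ _ hx2 hc1, h.map_sq hx]
  refine (even_two_mul _).add ?_
  rcases lt_trichotomy (ν c) 0 with hlt | heq | hgt
  · rwa [h.map_one_sub_of_neg hc0 hc1 hlt]
  · have h0 : ValGE ν 0 (1 - c) := h.valGE_sub (.inr h.map_one.ge) (.inr heq.ge)
    have h1 : ¬ ValGE ν 1 (1 - c) := fun h1 => hcs (h.isSquare_of_valGE_sub_one hodd (by
      have := h.valGE_neg h1
      rwa [neg_sub] at this))
    have h2 := h0.resolve_left hc1
    have h3 : ¬ 1 ≤ ν (1 - c) := fun h3 => h1 (.inr h3)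
    rw [show ν (1 - c) = 0 by omega]
    exact Even.zero
  · rw [h.map_one_sub_of_pos hc0 hc1 hgt]
    exact Even.zero

/-- Norms of even valuation from a ramified quadratic extension are squares. -/
theorem isSquare_sq_sub_mul_sq (h : IsNALocalField ν) (hodd : OddResidualChar ν) {p x y : K}
    (hp0 : p ≠ 0) (hp : ¬ Even (ν p)) (hn : x ^ 2 - p * y ^ 2 ≠ 0)
    (heven : Even (ν (x ^ 2 - p * y ^ 2))) : IsSquare (x ^ 2 - p * y ^ 2) := by
  rcases eq_or_ne y 0 with rfl | hy
  · simpa using IsSquare.sq x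
  have hpy : p * y ^ 2 ≠ 0 := mul_ne_zero hp0 (pow_ne_zero 2 hy)
  have hodd' : ¬ Even (ν (p * y ^ 2)) := by
    rw [h.map_mul _ _ hp0 (pow_ne_zero 2 hy), h.map_sq hy]
    simpa [Int.even_add] using hp
  rcases eq_or_ne x 0 with rfl | hx
  · refine absurd ?_ hodd'
    simpa [h.map_neg] using heven
  set c := p * y ^ 2 / x ^ 2 with hc
  have hx2 := pow_ne_zero 2 hx
  have hc0 : c ≠ 0 := div_ne_zero hpy hx2
  have hfac : x ^ 2 - p * y ^ 2 = x ^ 2 * (1 - c) := by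
    rw [hc]
    field_simp
  have hc1 : 1 - c ≠ 0 := by
    intro h0
    rw [hfac, h0, mul_zero] at hn
    exact hn rfl
  have hce : ¬ Even (ν c) := by
    rw [hc, h.map_div hpy hx2, h.map_sq hx]
    simpa [Int.even_sub] using hodd'
  rw [hfac, h.map_mul _ _ hx2 hc1, h.map_sq hx] at heven
  rw [hfac]
  refine (IsSquare.sq x).mul ?_
  rcases lt_trichotomy (ν c) 0 with hlt | heq | hgt
  · rw [h.map_one_sub_of_neg hc0 hc1 hlt] at heven
    refine absurd ?_ hce
    simpa [Int.even_add] using heven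
  · exact absurd (heq ▸ Even.zero) hce
  · exact h.isSquare_of_valGE_sub_one hodd (.inr (by
      rw [sub_sub_cancel_left, h.map_neg]
      omega))

/-- A common norm from the three quadratic extensions generated by two independent square
classes is a square. -/
theorem isSquare_of_norms (h : IsNALocalField ν) (hodd : OddResidualChar ν) {a d n : K}
    (ha : ¬ IsSquare a) (hd : ¬ IsSquare d) (had : ¬ IsSquare (a * d)) (hn : n ≠ 0)
    (hna : ∃ x y, n = x ^ 2 - a * y ^ 2) (hnd : ∃ x y, n = x ^ 2 - d * y ^ 2)
    (hnad : ∃ x y, n = x ^ 2 - a * d * y ^ 2) : IsSquare n := by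
  have ha0 : a ≠ 0 := by
    rintro rfl
    exact ha IsSquare.zero
  have hd0 : d ≠ 0 := by
    rintro rfl
    exact hd IsSquare.zero
  have key (e p : K) (he : ¬ IsSquare e) (hev : Even (ν e)) (hp0 : p ≠ 0) (hp : ¬ Even (ν p))
      (hne : ∃ x y, n = x ^ 2 - e * y ^ 2) (hnp : ∃ x y, n = x ^ 2 - p * y ^ 2) :
      IsSquare n := by
    obtain ⟨x, y, hxy⟩ := hne
    obtain ⟨z, w, hzw⟩ := hnp
    have hev' : Even (ν n) := by
      rw [hxy] at hn ⊢
      exact h.even_map_sq_sub_mul_sq hodd hev he hn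
    rw [hzw] at hn hev' ⊢
    exact h.isSquare_sq_sub_mul_sq hodd hp0 hp hn hev'
  by_cases hae : Even (ν a)
  · by_cases hde : Even (ν d)
    · exact absurd (h.isSquare_mul_of_even hodd ha0 hd0 hae hde ha hd) had
    · exact key a d ha hae hd0 hde hna hnd
  · by_cases hde : Even (ν d)
    · exact key d a hd hde ha0 hae hnd hna
    · refine key (a * d) a had ?_ ha0 hae hnad hna
      rw [h.map_mul _ _ ha0 hd0]
      exact (Int.not_even_iff_odd.mp hae).add_odd (Int.not_even_iff_odd.mp hde)

/-- A multiplicative set containing the nonzero squares, `d`, and the nonzero values of the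
norm forms of `a` and `a * d` contains every nonzero element, if `a` and `d` are independent
square classes. -/
theorem forall_of_norms (h : IsNALocalField ν) (hodd : OddResidualChar ν) {a d : K}
    (ha : ¬ IsSquare a) (hd : ¬ IsSquare d) (had : ¬ IsSquare (a * d)) {Q : K → Prop}
    (hmul : ∀ s t, Q s → Q t → Q (s * t)) (hsq : ∀ s, s ≠ 0 → Q (s ^ 2)) (hQd : Q d)
    (hQa : ∀ x y, x ^ 2 - a * y ^ 2 ≠ 0 → Q (x ^ 2 - a * y ^ 2))
    (hQad : ∀ x y, x ^ 2 - a * d * y ^ 2 ≠ 0 → Q (x ^ 2 - a * d * y ^ 2)) {t : K}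
    (ht : t ≠ 0) : Q t := by
  have ha0 : a ≠ 0 := by
    rintro rfl
    exact ha IsSquare.zero
  have hd0 : d ≠ 0 := by
    rintro rfl
    exact hd IsSquare.zero
  have had0 := mul_ne_zero ha0 hd0
  have hsq' {s : K} (hs0 : s ≠ 0) (hs : IsSquare s) : Q s := by
    obtain ⟨r, rfl⟩ := hs
    rw [← pow_two]
    exact hsq r (by rintro rfl; simp at hs0)
  have hclass {s r : K} (hs0 : s ≠ 0) (hr0 : r ≠ 0) (hr : Q r) (hsr : IsSquare (s * r)) :
      Q s := by
    have e : s = r * (s * r * (r⁻¹ ^ 2)) := by field_simp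
    rw [e]
    exact hmul _ _ hr (hsq' (mul_ne_zero (mul_ne_zero hs0 hr0) (pow_ne_zero 2 (inv_ne_zero hr0))) (hsr.mul (IsSquare.sq _)))
  have hneg_of {e : K} (he0 : e ≠ 0)
      (hQe : ∀ x y, x ^ 2 - e * y ^ 2 ≠ 0 → Q (x ^ 2 - e * y ^ 2)) (hs : IsSquare (-1 * e)) :
      Q (-1) := by
    obtain ⟨s, hs⟩ := hs
    have hs0 : s ≠ 0 := by
      rintro rfl
      simp [he0] at hs
    obtain ⟨x, y, hxy⟩ := h.exists_sq_add_sq_eq_neg_one hodd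
    have e1 : x ^ 2 - e * (y / s) ^ 2 = -1 := by
      rw [← hxy, show e = -(s * s) by linear_combination -hs]
      field_simp
      ring
    have := hQe x (y / s) (by rw [e1]; simp)
    rwa [e1] at this
  have hm1 : (-1 : K) ≠ 0 := by simp
  have hm1e : Even (ν (-1 : K)) := by
    rw [h.map_neg_one]
    exact Even.zero
  have hfinish (e p : K) (he : ¬ IsSquare e) (he0 : e ≠ 0) (hee : Even (ν e)) (hp0 : p ≠ 0)
      (hpo : ¬ Even (ν p)) (hQe : Q e) (hQp : Q p) : Q t := by
    have heven {s : K} (hs0 : s ≠ 0) (hse : Even (ν s)) : Q s := by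
      by_cases hs : IsSquare s
      · exact hsq' hs0 hs
      · exact hclass hs0 he0 hQe (h.isSquare_mul_of_even hodd hs0 he0 hse hee hs he)
    by_cases hte : Even (ν t)
    · exact heven ht hte
    · have : t = p * (t / p) := by field_simp
      rw [this]
      refine hmul _ _ hQp (heven (div_ne_zero ht hp0) ?_)
      rw [h.map_div ht hp0]
      exact (Int.not_even_iff_odd.mp hte).sub_odd (Int.not_even_iff_odd.mp hpo)
  have hade (hae : ¬ Even (ν a)) (hde : ¬ Even (ν d)) : Even (ν (a * d)) := by
    rw [h.map_mul _ _ ha0 hd0]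
    exact (Int.not_even_iff_odd.mp hae).add_odd (Int.not_even_iff_odd.mp hde)
  have hneg : Q (-1) := by
    by_cases hm : IsSquare (-1 : K)
    · exact hsq' hm1 hm
    by_cases hae : Even (ν a)
    · exact hneg_of ha0 hQa (h.isSquare_mul_of_even hodd hm1 ha0 hm1e hae hm ha)
    by_cases hde : Even (ν d)
    · exact hclass hm1 hd0 hQd (h.isSquare_mul_of_even hodd hm1 hd0 hm1e hde hm hd)
    · exact hneg_of had0 hQad
        (h.isSquare_mul_of_even hodd hm1 had0 hm1e (hade hae hde) hm had)
  have hQa' : Q a := by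
    simpa using hmul _ _ hneg (hQa 0 1 (by simpa using ha0))
  by_cases hae : Even (ν a)
  · by_cases hde : Even (ν d)
    · exact absurd (h.isSquare_mul_of_even hodd ha0 hd0 hae hde ha hd) had
    · exact hfinish a d ha ha0 hae hd0 hde hQa' hQd
  · by_cases hde : Even (ν d)
    · exact hfinish d a hd hd0 hde ha0 hae hQd hQa'
    · exact hfinish (a * d) a had had0 (hade hae hde) ha0 hae (hmul _ _ hQa' hQd) hQa'

end IsNALocalField

namespace IsBiquadratic

variable {F E : Type*} [Field F] [Field E] [Algebra F E]

theorem apply_apply (h : IsBiquadratic F E) (g : E ≃ₐ[F] E) (x : E) : g (g x) = x := by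
  obtain ⟨-, ⟨φ⟩⟩ := h
  have hexp : ∀ u : Multiplicative (ZMod 2 × ZMod 2), u * u = 1 := by decide
  have hg : g * g = 1 := φ.injective (by rw [map_mul, hexp, map_one])
  exact DFunLike.congr_fun hg x

theorem apply_comm (h : IsBiquadratic F E) (g k : E ≃ₐ[F] E) (x : E) :
    g (k x) = k (g x) := by
  obtain ⟨-, ⟨φ⟩⟩ := h
  have hg : g * k = k * g := φ.injective (by rw [map_mul, map_mul, mul_comm])
  exact DFunLike.congr_fun hg x

theorem exists_bijective [FiniteDimensional F E] (h : IsBiquadratic F E)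
    (hdim : Module.finrank F E = 4) {σ : E ≃ₐ[F] E} (hσ : σ ≠ 1) :
    ∃ τ : E ≃ₐ[F] E, Function.Bijective ![1, σ, τ, σ * τ] := by
  classical
  have := h.1
  have hcard : Fintype.card (E ≃ₐ[F] E) = 4 := by
    rw [← Nat.card_eq_fintype_card, IsGalois.card_aut_eq_finrank, hdim]
  obtain ⟨τ, hτ⟩ : ∃ τ, τ ∉ ({1, σ} : Finset (E ≃ₐ[F] E)) := by
    by_contra! hall
    have h1 := Finset.card_le_card (fun g _ => hall g :
      (Finset.univ : Finset (E ≃ₐ[F] E)) ⊆ {1, σ})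
    have h2 : ({1, σ} : Finset (E ≃ₐ[F] E)).card ≤ 2 := Finset.card_le_two
    rw [Finset.card_univ] at h1
    omega
  obtain ⟨hτ1, hτσ⟩ : τ ≠ 1 ∧ τ ≠ σ := by simpa using hτ
  have hστ : σ * τ ≠ 1 := by
    intro h1
    have hσσ : σ * σ = 1 := AlgEquiv.ext fun x => h.apply_apply σ x
    exact hτσ (mul_left_cancel (h1.trans hσσ.symm))
  refine ⟨τ, (Fintype.bijective_iff_injective_and_card _).mpr ⟨?_, by rw [hcard]; rfl⟩⟩
  intro i j hij
  fin_cases i <;> fin_cases j <;>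
    simp_all [eq_comm (a := (1 : E ≃ₐ[F] E)), eq_comm (a := σ) (b := τ)]

end IsBiquadratic

/-- Independence of characters for four automorphisms. -/
theorem exists_sum_mul_apply_ne_zero {F E : Type*} [Field F] [Field E] [Algebra F E]
    {n : ℕ} {f : Fin n → (E ≃ₐ[F] E)} (hf : Function.Injective f) {c : Fin n → E}
    (hc : c ≠ 0) : ∃ x, ∑ i, c i * f i x ≠ 0 := by
  by_contra! hall
  have hinj : Function.Injective fun i => ((f i : E →+* E) : E →* E) := fun i j hij =>
    hf (AlgEquiv.ext fun x => DFunLike.congr_fun hij x)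
  have hli := (linearIndependent_monoidHom E E).comp _ hinj
  refine hc (funext (Fintype.linearIndependent_iff.mp hli c (funext fun x => ?_)))
  simpa using hall x

/-- The norm of `z` along a quadratic subfield `F(ρ)`, fixed by `k`, is a value of the norm form
of `F(ρ)/F`. -/
theorem exists_eq_sq_sub_mul_sq {F E : Type*} [Field F] [Field E] [Algebra F E]
    (h2 : (2 : F) ≠ 0) {g k : E ≃ₐ[F] E}
    (hg : ∀ x, g (g x) = x) (hk : ∀ x, k (k x) = x) (hgk : ∀ x, k (g x) = g (k x))
    (hfix : ∀ x, g x = x → k x = x → ∃ t : F, algebraMap F E t = x)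
    {ρ : E} {r : F} (hρ0 : ρ ≠ 0) (hkρ : k ρ = ρ) (hgρ : g ρ = -ρ)
    (hr : algebraMap F E r = ρ ^ 2) (z : E) :
    ∃ x y : F, z * k z * g (z * k z) = algebraMap F E (x ^ 2 - r * y ^ 2) := by
  have h2E : (2 : E) ≠ 0 := by
    rw [← map_ofNat (algebraMap F E) 2]
    exact (map_ne_zero _).mpr h2
  have hkw : k (z * k z) = z * k z := by rw [map_mul, hk, mul_comm]
  generalize z * k z = w at hkw ⊢
  obtain ⟨x, hx⟩ := hfix ((w + g w) / 2)
    (by rw [map_div₀, map_add, hg, map_ofNat, add_comm])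
    (by rw [map_div₀, map_add, hgk, hkw, map_ofNat])
  obtain ⟨y, hy⟩ := hfix ((w - g w) / (2 * ρ))
    (by rw [map_div₀, map_sub, hg, map_mul, hgρ, map_ofNat]; field_simp; ring)
    (by rw [map_div₀, map_sub, hgk, hkw, map_mul, hkρ, map_ofNat])
  refine ⟨x, y, ?_⟩
  rw [map_sub, map_pow, map_mul, map_pow, hx, hy, hr]
  field_simp
  ring

/-- An element fixed by `k` and negated by `g` is not in `F`, so its square is not a square
in `F`. -/
theorem not_isSquare_of_apply_eq_neg {F E : Type*} [Field F] [Field E] [Algebra F E]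
    (h2 : (2 : F) ≠ 0) {g : E ≃ₐ[F] E} {ρ : E} {r : F} (hρ0 : ρ ≠ 0) (hgρ : g ρ = -ρ)
    (hr : algebraMap F E r = ρ ^ 2) : ¬ IsSquare r := by
  have h2E : (2 : E) ≠ 0 := by
    rw [← map_ofNat (algebraMap F E) 2]
    exact (map_ne_zero _).mpr h2
  rintro ⟨s, rfl⟩
  rw [map_mul, ← pow_two] at hr
  have hgs : g ρ = ρ := by
    rcases sq_eq_sq_iff_eq_or_eq_neg.mp hr.symm with h | h
    · rw [h, g.commutes]
    · rw [h, map_neg, g.commutes]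
  rw [hgs] at hgρ
  exact hρ0 ((mul_eq_zero.mp (by linear_combination hgρ : 2 * ρ = 0)).resolve_left h2E)

/-- Lemma of §3.2, second assertion.
If `E/F` is biquadratic (with `σ` of order 2 having fixed field the
intermediate quadratic subfield `E₀`, realized below as the `σ`-fixed
elements), then `N_{E/E₀}(E^×) = F^× · (E₀^×)²` and `N_{E/F}(E^×) = (F^×)²`.
Here `N_{E/E₀}(x) = x·σ(x)`. -/
theorem biquadratic_norm_groups
    {F E : Type*} [Field F] [Field E] [Algebra F E] [FiniteDimensional F E]
    (ν : F → ℤ) (hF : IsNALocalField ν) (hodd : OddResidualChar ν)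
    (hdim : Module.finrank F E = 4)
    (σ : E ≃ₐ[F] E) (hσ2 : ∀ x : E, σ (σ x) = x)
    (hσne : σ ≠ (AlgEquiv.refl : E ≃ₐ[F] E))
    (β : E) (hβskew : σ β = -β) (hβgen : Algebra.adjoin F {β} = ⊤)
    (hbiq : IsBiquadratic F E) :
    ({x : E | ∃ y : E, y ≠ 0 ∧ x = y * σ y} =
        {x : E | ∃ t : F, ∃ y : E, t ≠ 0 ∧ y ≠ 0 ∧ σ y = y ∧
          x = algebraMap F E t * y ^ 2}) ∧
      ({t : F | ∃ x : E, x ≠ 0 ∧ t = Algebra.norm F x} =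
        {t : F | ∃ s : F, s ≠ 0 ∧ t = s ^ 2}) := by
  classical
  have hgal := hbiq.1
  have h2 := hodd.1
  obtain ⟨τ, hbij⟩ := hbiq.exists_bijective hdim (σ := σ) hσne
  have hτ2 := hbiq.apply_apply τ
  have hcomm : ∀ x, σ (τ x) = τ (σ x) := hbiq.apply_comm σ τ
  have hfix : ∀ x, σ x = x → τ x = x → ∃ t : F, algebraMap F E t = x := by
    intro x hσx hτx
    refine (IsGalois.mem_range_algebraMap_iff_fixed x).mpr fun g => ?_
    obtain ⟨i, rfl⟩ := hbij.2 g
    fin_cases i <;> simp [hσx, hτx]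
  have hnorm (x : E) : algebraMap F E (Algebra.norm F x) = x * σ x * τ (x * σ x) := by
    rw [Algebra.norm_eq_prod_automorphisms, ← hbij.prod_comp, Fin.prod_univ_four]
    simp [hcomm, mul_assoc]
  obtain ⟨α, hα0, hσα, hτα⟩ : ∃ α : E, α ≠ 0 ∧ σ α = -α ∧ τ α = α := by
    obtain ⟨x, hx⟩ := exists_sum_mul_apply_ne_zero hbij.1
      (c := ![1, -1, 1, -1]) fun h => one_ne_zero (congrFun h 0)
    refine ⟨_, hx, ?_, ?_⟩ <;> simp [Fin.sum_univ_four, hσ2, hτ2, hcomm] <;> ring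
  obtain ⟨δ, hδ0, hσδ, hτδ⟩ : ∃ δ : E, δ ≠ 0 ∧ σ δ = δ ∧ τ δ = -δ := by
    obtain ⟨x, hx⟩ := exists_sum_mul_apply_ne_zero hbij.1
      (c := ![1, 1, -1, -1]) fun h => one_ne_zero (congrFun h 0)
    refine ⟨_, hx, ?_, ?_⟩ <;> simp [Fin.sum_univ_four, hσ2, hτ2, hcomm] <;> ring
  obtain ⟨a, ha⟩ := hfix (α ^ 2) (by simp [hσα]) (by simp [hτα])
  obtain ⟨d, hd⟩ := hfix (δ ^ 2) (by simp [hσδ]) (by simp [hτδ])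
  have had : algebraMap F E (a * d) = (α * δ) ^ 2 := by rw [map_mul, ha, hd, mul_pow]
  have hσαδ : σ (α * δ) = -(α * δ) := by rw [map_mul, hσα, hσδ, neg_mul]
  have hαδ0 := mul_ne_zero hα0 hδ0
  have hsa := not_isSquare_of_apply_eq_neg h2 hα0 hσα ha
  have hsd := not_isSquare_of_apply_eq_neg h2 hδ0 hτδ hd
  have hsad := not_isSquare_of_apply_eq_neg h2 hαδ0 hσαδ had
  have hinj := (algebraMap F E).injective
  have hnormsq {x : E} (hx : x ≠ 0) : IsSquare (Algebra.norm F x) := by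
    refine hF.isSquare_of_norms hodd hsa hsd hsad (Algebra.norm_ne_zero_iff.mpr hx) ?_ ?_ ?_
    · obtain ⟨u, v, huv⟩ := exists_eq_sq_sub_mul_sq h2 hσ2 hτ2 (fun x => (hcomm x).symm) hfix
        hα0 hτα hσα ha x
      refine ⟨u, v, hinj ?_⟩
      rw [← huv, hnorm]
      simp only [map_mul, hcomm]
      ring
    · obtain ⟨u, v, huv⟩ := exists_eq_sq_sub_mul_sq h2 hτ2 hσ2 hcomm
        (fun x h1 h2 => hfix x h2 h1) hδ0 hσδ hτδ hd x
      exact ⟨u, v, hinj (by rw [← huv, hnorm])⟩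
    · obtain ⟨u, v, huv⟩ := exists_eq_sq_sub_mul_sq (g := σ) (k := σ * τ) h2 hσ2
        (fun x => by simp [hcomm, hσ2, hτ2]) (fun x => by simp [hcomm])
        (fun x h1 h2 => hfix x h1 (by simpa [hcomm, h1] using h2)) hαδ0
        (by simp [hσα, hσδ, hτα, hτδ]) hσαδ had x
      refine ⟨u, v, hinj ?_⟩
      rw [← huv, hnorm]
      simp only [map_mul, AlgEquiv.mul_apply, hcomm, hσ2]
      ring
  have hbase {t : F} (ht : t ≠ 0) : ∃ z : E, algebraMap F E t = z * σ z := by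
    have hform {ρ : E} {r : F} (hσρ : σ ρ = -ρ) (hr : algebraMap F E r = ρ ^ 2) (x y : F) :
        ∃ z : E, algebraMap F E (x ^ 2 - r * y ^ 2) = z * σ z := by
      refine ⟨algebraMap F E x + ρ * algebraMap F E y, ?_⟩
      simp only [map_sub, map_add, map_mul, map_pow, hr, hσρ, σ.commutes]
      ring
    refine hF.forall_of_norms hodd hsa hsd hsad
      (Q := fun t => ∃ z : E, algebraMap F E t = z * σ z) ?_ ?_ ?_ ?_ ?_ ht
    · rintro s t ⟨z, hz⟩ ⟨w, hw⟩
      exact ⟨z * w, by rw [map_mul, map_mul, hz, hw]; ring⟩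
    · exact fun s _ => ⟨algebraMap F E s, by rw [σ.commutes, map_pow, pow_two]⟩
    · exact ⟨δ, by rw [hσδ, hd, pow_two]⟩
    · exact fun x y _ => hform hσα ha x y
    · exact fun x y _ => hform hσαδ had x y
  have hF0 {t : F} (ht : t ≠ 0) : algebraMap F E t ≠ 0 := (map_ne_zero _).mpr ht
  refine ⟨Set.ext fun x => ⟨?_, ?_⟩, Set.ext fun t => ⟨?_, ?_⟩⟩
  · rintro ⟨y, hy0, rfl⟩
    obtain ⟨s, hs⟩ := hnormsq hy0
    have hN := hnorm y
    have hx0 : y * σ y ≠ 0 := mul_ne_zero hy0 ((map_ne_zero σ).mpr hy0)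
    have hσx : σ (y * σ y) = y * σ y := by rw [map_mul, hσ2, mul_comm]
    generalize y * σ y = x at hN hx0 hσx
    rw [hs, map_mul] at hN
    have hs0 : s ≠ 0 := by
      rintro rfl
      exact Algebra.norm_ne_zero_iff.mpr hy0 (hs.trans (mul_zero 0))
    have hS0 := hF0 hs0
    rcases eq_or_ne (algebraMap F E s + x) 0 with h0 | h0
    · exact ⟨-s, 1, neg_ne_zero.mpr hs0, one_ne_zero, map_one σ,
        by rw [map_neg]; linear_combination h0⟩
    set w := algebraMap F E s + x with hw
    have hσw : σ w = w := by rw [hw, map_add, σ.commutes, hσx]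
    have hwτ : x * τ w = algebraMap F E s * w := by
      rw [hw, map_add, τ.commutes]
      linear_combination -hN
    have hτw0 : τ w ≠ 0 := (map_ne_zero τ).mpr h0
    obtain ⟨u, hu⟩ := hfix (w * τ w) (by rw [map_mul, hcomm, hσw])
      (by rw [map_mul, hτ2, mul_comm])
    have hu0 : u ≠ 0 := by
      rintro rfl
      rw [map_zero] at hu
      exact mul_ne_zero h0 hτw0 hu.symm
    refine ⟨s / u, w, div_ne_zero hs0 hu0, h0, hσw, ?_⟩
    rw [map_div₀, hu]
    field_simp
    linear_combination hwτ
  · rintro ⟨t, y, ht, hy0, hσy, rfl⟩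
    obtain ⟨z, hz⟩ := hbase ht
    have hz0 : z ≠ 0 := by
      rintro rfl
      exact hF0 ht (by simpa using hz)
    refine ⟨z * y, mul_ne_zero hz0 hy0, ?_⟩
    rw [map_mul, hσy, hz]
    ring
  · rintro ⟨x, hx0, rfl⟩
    obtain ⟨s, hs⟩ := hnormsq hx0
    refine ⟨s, ?_, by rw [hs, pow_two]⟩
    rintro rfl
    exact Algebra.norm_ne_zero_iff.mpr hx0 (hs.trans (mul_zero 0))
  · rintro ⟨s, hs0, rfl⟩
    obtain ⟨z, hz⟩ := hbase hs0
    refine ⟨z, ?_, hinj ?_⟩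
    · rintro rfl
      exact hF0 hs0 (by simpa using hz)
    · rw [hnorm, ← hz, τ.commutes, map_pow, pow_two]
end

section
/- Let x ∈ E₀^× be such that x z⁻¹ ∉ F^× · (E₀^×)² for every z ∈ E₀^× with tr_{E₀/F}(z) = 0 (i.e. x lies in the F^×(E₀^×)²-coset of E₀^× that does not contain the kernel of tr_{E₀/F}). Then tr_{E₀/F}(x) ≠ 0 and e(E₀/F) · ν_F(tr_{E₀/F}(x)) = ν_{E₀}(x). (Displayed claim in the proof of Lemma 5.2.1.) -/
namespace ValGE

variable {K : Type*} [Field K] {ν : K → ℤ} {M N : ℤ} {x y : K}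

theorem mono_s5 (hx : ValGE ν N x) (hMN : M ≤ N) : ValGE ν M x :=
  hx.imp id hMN.trans

theorem not_succ (hx : x ≠ 0) : ¬ValGE ν (ν x + 1) x := by
  rintro (h | h)
  · exact hx h
  · omega

theorem add (h : IsNALocalField ν) (hx : ValGE ν N x) (hy : ValGE ν N y) :
    ValGE ν N (x + y) := by
  rcases eq_or_ne x 0 with rfl | hx0
  · rwa [zero_add]
  rcases eq_or_ne y 0 with rfl | hy0
  · rwa [add_zero]
  by_cases hxy : x + y = 0
  · exact Or.inl hxy
  · exact Or.inr <|
      (le_min (hx.resolve_left hx0) (hy.resolve_left hy0)).trans (h.ultrametric x y hx0 hy0 hxy)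

theorem mul (h : IsNALocalField ν) (hx : ValGE ν M x) (hy : ValGE ν N y) :
    ValGE ν (M + N) (x * y) := by
  rcases hx with rfl | hx
  · exact Or.inl (zero_mul y)
  rcases hy with rfl | hy
  · exact Or.inl (mul_zero x)
  by_cases hx0 : x = 0
  · exact Or.inl (by simp [hx0])
  by_cases hy0 : y = 0
  · exact Or.inl (by simp [hy0])
  exact Or.inr (by rw [h.map_mul x y hx0 hy0]; exact add_le_add hx hy)

theorem neg (h : IsNALocalField ν) (hx : ValGE ν N x) : ValGE ν N (-x) := by
  have h1 : ValGE ν 0 (-1) := Or.inr h.map_neg_one.ge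
  simpa using mul h h1 hx

theorem sub (h : IsNALocalField ν) (hx : ValGE ν N x) (hy : ValGE ν N y) :
    ValGE ν N (x - y) := by
  simpa [sub_eq_add_neg] using add h hx (neg h hy)

end ValGE

namespace IsNALocalField

variable {K : Type*} [Field K] {ν : K → ℤ}

theorem valGE_one (h : IsNALocalField ν) : ValGE ν 0 (1 : K) :=
  Or.inr h.map_one.ge

/-- Subtracting an element of strictly larger valuation does not change the valuation. -/
theorem map_sub_eq (h : IsNALocalField ν) {x a : K} (hx : x ≠ 0)
    (ha : ValGE ν (ν x + 1) a) : x - a ≠ 0 ∧ ν (x - a) = ν x := by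
  have hne : x - a ≠ 0 := by
    intro h0
    rw [← sub_eq_zero.mp h0] at ha
    exact ValGE.not_succ hx ha
  refine ⟨hne, le_antisymm ?_ ?_⟩
  · by_contra! hlt
    have hw : ValGE ν (ν x + 1) (x - a) := Or.inr hlt
    exact ValGE.not_succ hx (by simpa using ValGE.add h hw ha)
  · have hxx : ValGE ν (ν x) x := Or.inr le_rfl
    exact (ValGE.sub h hxx (ha.mono_s5 (by omega))).resolve_left hne

/-- The iteration `s ↦ s + (u - s²) / 2`, converging to a square root of a principal unit `u`. -/
def sqrtApprox (u : K) : ℕ → K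
  | 0 => 1
  | k + 1 => sqrtApprox u k + (u - sqrtApprox u k ^ 2) * 2⁻¹

theorem valGE_sqrtApprox (h : IsNALocalField ν) (h2 : OddResidualChar ν) {u : K}
    (hu : ValGE ν 1 (u - 1)) (k : ℕ) :
    ValGE ν 1 (sqrtApprox u k - 1) ∧ ValGE ν (k + 1) (u - sqrtApprox u k ^ 2) := by
  have hhalf : ValGE ν 0 (2⁻¹ : K) := Or.inr (by rw [h.map_inv h2.1, h2.2, neg_zero])
  have h20 : (2 : K) ≠ 0 := h2.1
  induction k with
  | zero => exact ⟨Or.inl (sub_self 1), by simpa [sqrtApprox] using hu⟩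
  | succ k ih =>
    obtain ⟨h1, hr⟩ := ih
    have hstep := ValGE.mul h hr hhalf
    refine ⟨?_, ?_⟩
    · have := ValGE.add h h1 (hstep.mono_s5 (show (1 : ℤ) ≤ _ by omega))
      convert this using 1
      rw [sqrtApprox]
      ring
    · have ha := (ValGE.neg h (ValGE.mul h hr h1)).mono_s5
        (show ((k + 1 : ℕ) : ℤ) + 1 ≤ _ by push_cast; omega)
      have hb := (ValGE.mul h hstep hstep).mono_s5
        (show ((k + 1 : ℕ) : ℤ) + 1 ≤ _ by push_cast; omega)
      convert ValGE.sub h ha hb using 1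
      rw [sqrtApprox]
      field_simp
      ring

theorem valGE_sqrtApprox_sub (h : IsNALocalField ν) (h2 : OddResidualChar ν) {u : K}
    (hu : ValGE ν 1 (u - 1)) (m k : ℕ) :
    ValGE ν (m + 1) (sqrtApprox u (m + k) - sqrtApprox u m) := by
  have hhalf : ValGE ν 0 (2⁻¹ : K) := Or.inr (by rw [h.map_inv h2.1, h2.2, neg_zero])
  induction k with
  | zero => exact Or.inl (sub_self _)
  | succ k ih =>
    have hr := (ValGE.mul h (h.valGE_sqrtApprox h2 hu (m + k)).2 hhalf).mono_s5
      (show (m : ℤ) + 1 ≤ _ by push_cast; omega)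
    convert ValGE.add h ih hr using 1
    rw [← add_assoc, sqrtApprox]
    ring

/-- In odd residual characteristic every principal unit is a square. -/
theorem exists_sq_eq (h : IsNALocalField ν) (h2 : OddResidualChar ν) {u : K}
    (hu : ValGE ν 1 (u - 1)) : ∃ s : K, s ^ 2 = u := by
  obtain ⟨L, hL⟩ := h.complete (sqrtApprox u) (by
    intro N
    refine ⟨N.toNat, fun m hm n hn => ?_⟩
    suffices hV : ValGE ν N (sqrtApprox u m - sqrtApprox u n) from hV.imp sub_eq_zero.mp id
    obtain ⟨i, rfl⟩ := Nat.exists_eq_add_of_le hm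
    obtain ⟨j, rfl⟩ := Nat.exists_eq_add_of_le hn
    convert (ValGE.sub h (h.valGE_sqrtApprox_sub h2 hu N.toNat i)
      (h.valGE_sqrtApprox_sub h2 hu N.toNat j)).mono_s5 (show N ≤ _ by omega) using 1
    ring)
  refine ⟨L, ?_⟩
  by_contra hne
  have hne' : L ^ 2 - u ≠ 0 := sub_ne_zero.mpr hne
  refine ValGE.not_succ (ν := ν) hne' ?_
  set N := ν (L ^ 2 - u) + 1
  obtain ⟨M, hM⟩ := hL (max N 0)
  set m := max M N.toNat with hm
  have hd : ValGE ν (max N 0) (sqrtApprox u m - L) :=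
    (hM m (le_max_left _ _)).imp sub_eq_zero.mpr id
  obtain ⟨h1, hr⟩ := h.valGE_sqrtApprox h2 hu m
  have hs : ValGE ν 0 (sqrtApprox u m) := by
    simpa using ValGE.add h (h1.mono_s5 zero_le_one) h.valGE_one
  have hsum : ValGE ν 0 (sqrtApprox u m + L) := by
    convert ValGE.sub h (ValGE.add h hs hs) (hd.mono_s5 (le_max_right _ _)) using 1
    ring
  have hA := (ValGE.mul h hd hsum).mono_s5 (show N ≤ _ by omega)
  convert ValGE.neg h (ValGE.add h hA (hr.mono_s5 (show N ≤ _ by omega))) using 1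
  ring

end IsNALocalField

/-- Trace-zero elements of a quadratic extension have their square in the base field. -/
theorem exists_algebraMap_eq_sq_of_trace_eq_zero {F E : Type*} [Field F] [Field E] [Algebra F E]
    [FiniteDimensional F E] (hdim : Module.finrank F E = 2) {w : E}
    (hw : Algebra.trace F E w = 0) : ∃ c : F, algebraMap F E c = w ^ 2 := by
  let b := Module.finBasisOfFinrankEq F E hdim
  let A := Algebra.leftMulMatrix b w
  have htr : A.trace = 0 := by rw [← hw, Algebra.trace_eq_matrix_trace b]
  refine ⟨-A.det, Algebra.leftMulMatrix_injective b ?_⟩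
  have hCH := A.aeval_self_charpoly
  rw [Matrix.charpoly_fin_two, htr] at hCH
  rw [map_pow, AlgHom.commutes, map_neg]
  simp only [map_zero, zero_mul, sub_zero, map_add, map_pow, Polynomial.aeval_X,
    Polynomial.aeval_C] at hCH
  exact (eq_neg_of_add_eq_zero_left hCH).symm

/-- displayed claim in the proof of Lemma 5.2.1.
Let `E₀/F` be a quadratic extension of nonarchimedean local fields of odd
residual characteristic, with normalized valuations `ν_F`, `ν_{E₀}` and
ramification index `e = e(E₀/F)`.  If `x ∈ E₀^×` lies in the
`F^×(E₀^×)²`-coset of `E₀^×` not containing the kernel of `tr_{E₀/F}`, then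
`tr_{E₀/F}(x) ≠ 0` and `e(E₀/F)·ν_F(tr_{E₀/F}(x)) = ν_{E₀}(x)`. -/
theorem valuation_of_trace
    {F E₀ : Type*} [Field F] [Field E₀] [Algebra F E₀] [FiniteDimensional F E₀]
    (νF : F → ℤ) (ν₀ : E₀ → ℤ)
    (hF : IsNALocalField νF) (hE₀ : IsNALocalField ν₀)
    (hodd : OddResidualChar ν₀)
    (hdim : Module.finrank F E₀ = 2)
    (e : ℤ) (he : 0 < e)
    (hcompat : ∀ t : F, t ≠ 0 → ν₀ (algebraMap F E₀ t) = e * νF t)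
    (x : E₀) (hx : x ≠ 0)
    (hcoset : ∀ z : E₀, z ≠ 0 → Algebra.trace F E₀ z = 0 →
      ¬∃ t : F, ∃ y : E₀, t ≠ 0 ∧ y ≠ 0 ∧ x * z⁻¹ = algebraMap F E₀ t * y ^ 2) :
    Algebra.trace F E₀ x ≠ 0 ∧ e * νF (Algebra.trace F E₀ x) = ν₀ x := by
  set T := Algebra.trace F E₀ x with hT
  have h2E : (2 : E₀) ≠ 0 := hodd.1
  have hmap2 : algebraMap F E₀ 2 = 2 := map_ofNat _ 2
  have h2F : (2 : F) ≠ 0 := by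
    intro h0
    rw [h0, map_zero] at hmap2
    exact h2E hmap2.symm
  have hoddF : OddResidualChar νF := by
    refine ⟨h2F, ?_⟩
    have := hcompat 2 h2F
    rw [hmap2, hodd.2] at this
    exact (mul_eq_zero.mp this.symm).resolve_left he.ne'
  have htrmap : ∀ r : F, Algebra.trace F E₀ (algebraMap F E₀ r) = 2 * r := by
    intro r
    rw [Algebra.trace_algebraMap, hdim, nsmul_eq_mul, Nat.cast_ofNat]
  set a : E₀ := algebraMap F E₀ (T / 2) with ha
  have htw : Algebra.trace F E₀ (x - a) = 0 := by
    rw [map_sub, ha, htrmap, ← hT]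
    field_simp
    ring
  have hnot : ¬ValGE ν₀ (ν₀ x + 1) a := by
    intro hV
    obtain ⟨hw, hvw⟩ := hE₀.map_sub_eq hx hV
    have hquot : ValGE ν₀ 1 (x * (x - a)⁻¹ - 1) := by
      have hinv : ValGE ν₀ (-ν₀ x) (x - a)⁻¹ := Or.inr (by rw [hE₀.map_inv hw, hvw])
      convert (ValGE.mul hE₀ hV hinv).mono_s5 (show (1 : ℤ) ≤ _ by omega) using 1
      field_simp
      ring
    obtain ⟨s, hs⟩ := hE₀.exists_sq_eq hodd hquot
    refine hcoset (x - a) hw htw ⟨1, s, one_ne_zero, ?_, by rw [map_one, one_mul, hs]⟩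
    rintro rfl
    rw [zero_pow two_ne_zero] at hs
    exact mul_ne_zero hx (inv_ne_zero hw) hs.symm
  have ha0 : a ≠ 0 := fun h0 => hnot (Or.inl h0)
  have hT0 : T ≠ 0 := by
    intro h0
    rw [h0, zero_div, map_zero] at ha
    exact ha0 ha
  have hle : ν₀ a ≤ ν₀ x := by
    by_contra! h
    exact hnot (Or.inr h)
  have hge : ν₀ x ≤ ν₀ a := by
    by_contra! hlt
    have htq : Algebra.trace F E₀ (x / a - 1) = 0 := by
      have hd : x / a - 1 = (T / 2)⁻¹ • (x - a) := by
        rw [Algebra.smul_def, map_inv₀, ← ha]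
        field_simp
      rw [hd, map_smul, htw, smul_zero]
    obtain ⟨c, hc⟩ := exists_algebraMap_eq_sq_of_trace_eq_zero hdim htq
    have hq : ValGE ν₀ 1 (x / a) := by
      refine Or.inr ?_
      rw [div_eq_mul_inv, hE₀.map_mul _ _ hx (inv_ne_zero ha0), hE₀.map_inv ha0]
      omega
    have hc1 : ValGE νF 1 (c - 1) := by
      by_cases hc0 : c - 1 = 0
      · exact Or.inl hc0
      have hm : ValGE ν₀ 1 (algebraMap F E₀ (c - 1)) := by
        have h2q : ValGE ν₀ 1 (2 * (x / a)) := by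
          rw [two_mul]
          exact ValGE.add hE₀ hq hq
        convert ValGE.sub hE₀ ((ValGE.mul hE₀ hq hq).mono_s5 (show (1 : ℤ) ≤ _ by omega)) h2q using 1
        rw [map_sub, hc, map_one]
        ring
      have hpos := hm.resolve_left ((map_ne_zero (algebraMap F E₀)).mpr hc0)
      rw [hcompat _ hc0] at hpos
      exact Or.inr (pos_of_mul_pos_right (by omega : 0 < e * νF (c - 1)) he.le)
    obtain ⟨s, hs⟩ := hF.exists_sq_eq hoddF hc1
    have hrat : ∃ r : F, x / a - 1 = algebraMap F E₀ r := by
      rw [← hs, map_pow] at hc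
      rcases sq_eq_sq_iff_eq_or_eq_neg.mp hc with h | h
      · exact ⟨s, h.symm⟩
      · exact ⟨-s, by rw [map_neg, h, neg_neg]⟩
    obtain ⟨r, hr⟩ := hrat
    rw [hr, htrmap] at htq
    rw [(mul_eq_zero.mp htq).resolve_left h2F, map_zero, sub_eq_zero, div_eq_one_iff_eq ha0] at hr
    rw [hr] at hlt
    exact lt_irrefl _ hlt
  refine ⟨hT0, ?_⟩
  have hTa : algebraMap F E₀ T = 2 * a := by
    rw [ha, map_div₀, hmap2]
    field_simp
  rw [← hcompat T hT0, hTa, hE₀.map_mul _ _ h2E ha0, hodd.2, zero_add]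
  exact le_antisymm hle hge
end

section
/- Fix g ∈ Sp(V,h) and k ∈ {−2,−1,1,2}, and let ε(k) denote the sign of k. (1) For every x ∈ F, tr(β · (x · g t_k g⁻¹)) = ε(k) · x · h(g e_{−k}, β(g e_{−k})), and hence ψ_β(1 + x · g t_k g⁻¹) = ψ(ε(k) · x · h(g e_{−k}, β(g e_{−k}))). (2) If h(g e_{−k}, β(g e_{−k})) ≠ 0, then for every s ∈ ℤ the function ψ_β is nontrivial on {1 + x · g t_k g⁻¹ : x ∈ 𝔭_F^s} if and only if s ≤ −ν_F(h(g e_{−k}, β(g e_{−k}))); if h(g e_{−k}, β(g e_{−k})) = 0 then ψ_β is identically 1 on g U_k g⁻¹. (Lemma 5.1.1.) -/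
/-- A transvection-type map sending `e k` to `e (-k)` and killing the other vectors of a
symplectic basis is given by pairing with `e (-k)`. -/
theorem apply_eq_pairing_smul_of_symplectic_basis
    {F V : Type*} [Field F] [AddCommGroup V] [Module F V]
    (h : V →ₗ[F] V →ₗ[F] F) (halt : ∀ v : V, h v v = 0) (e : ℤ → V)
    (hspan : Submodule.span F {e (-2), e (-1), e 1, e 2} = ⊤)
    (hsymp : ∀ i ∈ ({1, 2} : Set ℤ), ∀ j ∈ ({1, 2} : Set ℤ),
      h (e (-i)) (e j) = (if i = j then 1 else 0) ∧
        h (e i) (e j) = 0 ∧ h (e (-i)) (e (-j)) = 0)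
    (k : ℤ) (hk : k ∈ ({-2, -1, 1, 2} : Set ℤ))
    (t : V →ₗ[F] V) (ht : t (e k) = e (-k))
    (ht0 : ∀ s ∈ ({-2, -1, 1, 2} : Set ℤ), s ≠ k → t (e s) = 0) (v : V) :
    t v = ((if 0 < k then 1 else -1) * h (e (-k)) v) • e (-k) := by
  have hneg : ∀ v w : V, h v w = -h w v := fun v w ↦
    (LinearMap.IsAlt.neg (B := h) halt w v).symm
  have h11 := hsymp 1 (by simp) 1 (by simp)
  have h12 := hsymp 1 (by simp) 2 (by simp)
  have h21 := hsymp 2 (by simp) 1 (by simp)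
  have h22 := hsymp 2 (by simp) 2 (by simp)
  have hm2 := ht0 (-2) (by simp)
  have hm1 := ht0 (-1) (by simp)
  have hp1 := ht0 1 (by simp)
  have hp2 := ht0 2 (by simp)
  have n11 := hneg (e 1) (e (-1))
  have n12 := hneg (e 1) (e (-2))
  have n21 := hneg (e 2) (e (-1))
  have n22 := hneg (e 2) (e (-2))
  have hv : v ∈ Submodule.span F {e (-2), e (-1), e 1, e 2} := hspan ▸ Submodule.mem_top
  clear hneg hsymp ht0 hspan
  induction hv using Submodule.span_induction with
  | mem x hx =>
    simp only [Set.mem_insert_iff, Set.mem_singleton_iff] at hx hk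
    rcases hk with rfl | rfl | rfl | rfl <;> rcases hx with rfl | rfl | rfl | rfl <;> simp_all
  | zero => simp
  | add x y _ _ hx hy => rw [map_add, map_add, hx, hy, mul_add, add_smul]
  | smul a x _ hx => rw [map_smul, map_smul, hx, smul_smul, smul_eq_mul, mul_left_comm]

/-- The normalized valuation of a nonarchimedean local field vanishes at signs. -/
theorem IsNALocalField.map_sign {K : Type*} [Field K] {ν : K → ℤ} (hF : IsNALocalField ν)
    {a : K} (ha : a * a = 1) : ν a = 0 := by
  have ha0 : a ≠ 0 := by rintro rfl; simp at ha
  have h1 := hF.map_mul 1 1 one_ne_zero one_ne_zero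
  have h2 := hF.map_mul a a ha0 ha0
  rw [mul_one] at h1
  rw [ha] at h2
  omega

/-- Lemma 5.1.1.
Fix a symplectic basis `(e_{−2}, e_{−1}, e₁, e₂)` of the 4-dimensional
symplectic space `(V,h)` over the nonarchimedean local field `F`,
`k ∈ {−2,−1,1,2}` with long-root generator `t_k` (sending `e_k` to `e_{−k}`
and the other basis vectors to `0`), `g ∈ Sp(V,h)` (with inverse `g'`) and an
endomorphism `β` of `V`.  Then:
(1) `tr(β·(x·g t_k g⁻¹)) = ε(k)·x·h(g e_{−k}, β g e_{−k})`, so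
`ψ_β(1 + x·g t_k g⁻¹) = ψ(ε(k)·x·h(g e_{−k}, β g e_{−k}))`; and
(2) if `h(g e_{−k}, β g e_{−k}) ≠ 0` then for `s ∈ ℤ`, `ψ_β` is nontrivial on
`{1 + x·g t_k g⁻¹ : x ∈ 𝔭_F^s}` iff `s ≤ −ν_F(h(g e_{−k}, β g e_{−k}))`,
while if `h(g e_{−k}, β g e_{−k}) = 0` then `ψ_β ≡ 1` on `g U_k g⁻¹`. -/
theorem psibeta_on_conjugate_root_subgroup
    {F V : Type*} [Field F] [AddCommGroup V] [Module F V] [FiniteDimensional F V]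
    (ν : F → ℤ) (hF : IsNALocalField ν) (hodd : OddResidualChar ν)
    (ψ : F → ℂ) (hψadd : ∀ x y : F, ψ (x + y) = ψ x * ψ y) (hψ0 : ψ 0 = 1)
    (hψtriv : ∀ x : F, x ≠ 0 → 0 < ν x → ψ x = 1)
    (hψnt : ∃ x : F, x ≠ 0 ∧ 0 ≤ ν x ∧ ψ x ≠ 1)
    (hdim : Module.finrank F V = 4)
    (h : V →ₗ[F] V →ₗ[F] F)
    (halt : ∀ v : V, h v v = 0)
    (hnd : ∀ v : V, (∀ w : V, h v w = 0) → v = 0)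
    (e : ℤ → V)
    (hspan : Submodule.span F {e (-2), e (-1), e 1, e 2} = ⊤)
    (hsymp : ∀ i ∈ ({1, 2} : Set ℤ), ∀ j ∈ ({1, 2} : Set ℤ),
      h (e (-i)) (e j) = (if i = j then 1 else 0) ∧
        h (e i) (e j) = 0 ∧ h (e (-i)) (e (-j)) = 0)
    (β : V →ₗ[F] V)
    (k : ℤ) (hk : k ∈ ({-2, -1, 1, 2} : Set ℤ))
    (t : V →ₗ[F] V) (ht : t (e k) = e (-k))
    (ht0 : ∀ s ∈ ({-2, -1, 1, 2} : Set ℤ), s ≠ k → t (e s) = 0)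
    (g g' : V →ₗ[F] V)
    (hgg' : g ∘ₗ g' = LinearMap.id) (hg'g : g' ∘ₗ g = LinearMap.id)
    (hgsymp : ∀ v w : V, h (g v) (g w) = h v w) :
    (∀ x : F,
      LinearMap.trace F V (β ∘ₗ (x • (g ∘ₗ t ∘ₗ g'))) =
          (if 0 < k then 1 else -1) * x * h (g (e (-k))) (β (g (e (-k)))) ∧
        ψ (LinearMap.trace F V
            (β ∘ₗ ((LinearMap.id + x • (g ∘ₗ t ∘ₗ g')) - LinearMap.id))) =
          ψ ((if 0 < k then 1 else -1) * x *
            h (g (e (-k))) (β (g (e (-k)))))) ∧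
    (h (g (e (-k))) (β (g (e (-k)))) ≠ 0 →
      ∀ s : ℤ,
        (∃ x : F, (x = 0 ∨ s ≤ ν x) ∧
            ψ (LinearMap.trace F V (β ∘ₗ (x • (g ∘ₗ t ∘ₗ g')))) ≠ 1) ↔
          s ≤ -ν (h (g (e (-k))) (β (g (e (-k)))))) ∧
    (h (g (e (-k))) (β (g (e (-k)))) = 0 →
      ∀ x : F, ψ (LinearMap.trace F V (β ∘ₗ (x • (g ∘ₗ t ∘ₗ g')))) = 1) := by
  set w := g (e (-k)) with hw
  set c := h w (β w) with hc
  obtain ⟨ε, hε⟩ : ∃ ε : F, (if 0 < k then 1 else -1) = ε := ⟨_, rfl⟩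
  have hεsq : ε * ε = 1 := by rw [← hε]; split_ifs <;> simp
  have htv := apply_eq_pairing_smul_of_symplectic_basis h halt e hspan hsymp k hk t ht ht0
  have htrace : ∀ x : F,
      LinearMap.trace F V (β ∘ₗ (x • (g ∘ₗ t ∘ₗ g'))) = ε * x * c := by
    intro x
    have hrank : β ∘ₗ (x • (g ∘ₗ t ∘ₗ g')) = ((ε * x) • h w).smulRight (β w) := by
      ext v
      have hv : h (e (-k)) (g' v) = h w v := by
        rw [← hgsymp, ← LinearMap.comp_apply g g', hgg', LinearMap.id_apply]
      simp only [LinearMap.comp_apply, LinearMap.smul_apply, LinearMap.smulRight_apply, htv, hv,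
        hε, map_smul, smul_smul, smul_eq_mul, ← hw]
      congr 1
      ring
    rw [hrank, LinearMap.trace_smulRight, LinearMap.smul_apply, smul_eq_mul]
  rw [hε]
  refine ⟨fun x ↦ ⟨htrace x, by rw [add_sub_cancel_left, htrace]⟩, fun hc0 s ↦ ?_, fun hc0 x ↦ ?_⟩
  · have hε0 : ε ≠ 0 := left_ne_zero_of_mul_eq_one hεsq
    have hνε : ν ε = 0 := hF.map_sign hεsq
    have hν : ∀ x : F, x ≠ 0 → ν (ε * x * c) = ν x + ν c := fun x hx ↦ by
      rw [hF.map_mul _ _ (mul_ne_zero hε0 hx) hc0, hF.map_mul _ _ hε0 hx, hνε, zero_add]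
    simp only [htrace]
    constructor
    · rintro ⟨x, hxs, hx⟩
      have hx0 : x ≠ 0 := by
        rintro rfl
        simp [hψ0] at hx
      have hle : ¬ 0 < ν (ε * x * c) := fun hlt ↦
        hx (hψtriv _ (mul_ne_zero (mul_ne_zero hε0 hx0) hc0) hlt)
      rw [hν x hx0] at hle
      have hsx := hxs.resolve_left hx0
      omega
    · intro hs
      obtain ⟨y, hy0, hy, hψy⟩ := hψnt
      have hxy : ε * (ε * y / c) * c = y := by
        rw [mul_assoc, div_mul_cancel₀ _ hc0, ← mul_assoc, hεsq, one_mul]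
      have hνx := hν (ε * y / c) (div_ne_zero (mul_ne_zero hε0 hy0) hc0)
      rw [hxy] at hνx
      exact ⟨ε * y / c, Or.inr (by omega), by rwa [hxy]⟩
  · rw [htrace, hc0, mul_zero, hψ0]
end
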